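/- arXiv:0909.4563 — 5 statements merged into one kernel-verified Lean document; each statement's English description precedes it below -/
import Mathlib

section
/- Let C = {f : ℕ → [-1,1] : the range of f is exactly {-1,+1}}. Then |C| = 𝔠 = 2^ℵ0, and for every n ≥ 1 and all functions φ_1, …, φ_n : ℕ → [-1,1], the set C ∩ {Σ_{i=1}^n g_i ∘ φ_i : g_1,…,g_n ∈ C(ℝ)} is countable. Consequently basic(ℕ,[-1,1]) = 𝔠. -/
open Cardinal Set Topology

noncomputable section

/-- A family `Φ ⊆ C(X)` is basic if every continuous real-valued function on `X`
is a finite sum of compositions `gᵢ ∘ φᵢ` with `φᵢ ∈ Φ` and `gᵢ ∈ C(ℝ)`. -/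
def IsBasicFamily {X : Type u} [TopologicalSpace X] (Φ : Set C(X, ℝ)) : Prop :=
  ∀ f : C(X, ℝ), ∃ (m : ℕ) (φ : Fin m → C(X, ℝ)) (g : Fin m → C(ℝ, ℝ)),
    (∀ i, φ i ∈ Φ) ∧ ∀ x, f x = ∑ i, g i (φ i x)

/-- `basic(X)`: the least cardinality of a basic family for `X`. -/
def basicCard (X : Type u) [TopologicalSpace X] : Cardinal.{u} :=
  sInf { c | ∃ Φ : Set C(X, ℝ), IsBasicFamily Φ ∧ #Φ = c }

/-- `dim X ≤ n`: every continuous map of a closed subspace of `X` into the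
`n`-sphere extends continuously over `X`. -/
def DimLE (X : Type u) [TopologicalSpace X] (n : ℕ) : Prop :=
  ∀ A : Set X, IsClosed A →
    ∀ f : C(A, Metric.sphere (0 : EuclideanSpace ℝ (Fin (n + 1))) 1),
      ∃ F : C(X, Metric.sphere (0 : EuclideanSpace ℝ (Fin (n + 1))) 1),
        ∀ a : A, F a = f a

/-- A Cantor set in `Y` is a subspace homeomorphic to the Cantor space `{0,1}^ℕ`. -/
def IsCantorSet {Y : Type u} [TopologicalSpace Y] (C : Set Y) : Prop :=
  Nonempty (C ≃ₜ (ℕ → Bool))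

/-- Strong independence of a family `𝒞 ⊆ C(X)`. -/
def StronglyIndep {X : Type u} [TopologicalSpace X] (𝒞 : Set C(X, ℝ)) : Prop :=
  ∀ (n : ℕ) (φ : C(X, Fin n → ℝ)),
    #(𝒞 ∩ { f : C(X, ℝ) | ∃ g : C((Fin n → ℝ), ℝ), ∀ x, f x = g (φ x) } : Set C(X, ℝ)) ≤ n

/-- Weak independence of a family `𝒞 ⊆ C(X)`. -/
def WeaklyIndep {X : Type u} [TopologicalSpace X] (𝒞 : Set C(X, ℝ)) : Prop :=
  ∀ (n : ℕ) (φ : Fin n → C(X, ℝ)),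
    #(𝒞 ∩ { f : C(X, ℝ) | ∃ g : Fin n → C(ℝ, ℝ), ∀ x, f x = ∑ i, g i (φ i x) } : Set C(X, ℝ)) < 𝔠

/-- The weight of a topological space: least cardinality of a basis. -/
def weightCard (X : Type u) [TopologicalSpace X] : Cardinal.{u} :=
  sInf { c | ∃ B : Set (Set X), TopologicalSpace.IsTopologicalBasis B ∧ #B = c }

/-- `cof([κ]^{ℵ₀}, ⊆)`: least cardinality of a family of countably infinite subsets
of (a set of size) `κ` which is cofinal in the countably infinite subsets. -/
def cofCtblSubsets (κ : Cardinal.{u}) : Cardinal.{u} :=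
  sInf { c | ∃ 𝒞 : Set (Set κ.out),
    (∀ C ∈ 𝒞, C.Countable ∧ C.Infinite) ∧
    (∀ S : Set κ.out, S.Countable → S.Infinite → ∃ C ∈ 𝒞, S ⊆ C) ∧ #𝒞 = c }


/-- The metric fan: `(ℕ × ℕ) ∪ {∗}`, points of `ℕ × ℕ` isolated, and a set `U`
containing `∗` is open iff it contains `[N,∞) × ℕ` for some `N`. -/
def Fan : Type := (ℕ × ℕ) ⊕ Unit

instance : TopologicalSpace Fan where
  IsOpen U := Sum.inr () ∈ U → ∃ N : ℕ, ∀ p : ℕ × ℕ, N ≤ p.1 → Sum.inl p ∈ U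
  isOpen_univ := fun _ => ⟨0, fun _ _ => trivial⟩
  isOpen_inter := by
    rintro s t hs ht hmem
    obtain ⟨N, hN⟩ := hs hmem.1
    obtain ⟨M, hM⟩ := ht hmem.2
    exact ⟨max N M, fun p hp =>
      ⟨hN p (le_trans (le_max_left _ _) hp), hM p (le_trans (le_max_right _ _) hp)⟩⟩
  isOpen_sUnion := by
    intro S hS hmem
    obtain ⟨U, hU, hmemU⟩ := hmem
    obtain ⟨N, hN⟩ := hS U hU hmemU
    exact ⟨N, fun p hp => ⟨U, hU, hN p hp⟩⟩

/-- A family of functions `ℕ → [-1,1]` basic for `ℕ` into `[-1,1]`. -/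
def IsBasicNatIcc (Φ : Set (ℕ → ℝ)) : Prop :=
  (∀ φ ∈ Φ, ∀ k, φ k ∈ Set.Icc (-1:ℝ) 1) ∧
  ∀ f : ℕ → ℝ, (∀ k, f k ∈ Set.Icc (-1:ℝ) 1) →
    ∃ (m : ℕ) (φ : Fin m → (ℕ → ℝ)) (g : Fin m → C(ℝ, ℝ)),
      (∀ i, φ i ∈ Φ) ∧ ∀ k, f k = ∑ i, g i (φ i k)

/-- `basic(ℕ, [-1,1])`. -/
def basicNatIcc : Cardinal :=
  sInf { c | ∃ Φ : Set (ℕ → ℝ), IsBasicNatIcc Φ ∧ #Φ = c }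

lemma countable_range_pair_inter_sums {n : ℕ} (φ : Fin n → (ℕ → ℝ))
    (hφ : ∀ i k, φ i k ∈ Set.Icc (-1:ℝ) 1) :
    (({ f : ℕ → ℝ | Set.range f = {-1, 1} } : Set (ℕ → ℝ)) ∩
      { f : ℕ → ℝ | ∃ g : Fin n → C(ℝ, ℝ), ∀ k, f k = ∑ i, g i (φ i k) }).Countable := by
  set S := (({ f : ℕ → ℝ | Set.range f = {-1, 1} } : Set (ℕ → ℝ)) ∩
      { f : ℕ → ℝ | ∃ g : Fin n → C(ℝ, ℝ), ∀ k, f k = ∑ i, g i (φ i k) })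
  have hex : ∀ f : ℕ → ℝ, ∃ G : Fin n → C(Set.Icc (-1:ℝ) 1, ℝ),
      f ∈ S → ∀ k, f k = ∑ i, G i ⟨φ i k, hφ i k⟩ := by
    intro f
    by_cases hf : f ∈ S
    · obtain ⟨g, hg⟩ := hf.2
      exact ⟨fun i => (g i).restrict _, fun _ k => by simpa using hg k⟩
    · exact ⟨0, fun h => absurd h hf⟩
  choose G hG using hex
  set r : ℝ := 1 / (n + 1) with hr
  have hr0 : 0 < r := by positivity
  refine Set.PairwiseDisjoint.countable_of_isOpen (s := fun f => Metric.ball (G f) r)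
    (a := S) ?_ (fun _ _ => Metric.isOpen_ball) (fun f _ => ⟨G f, Metric.mem_ball_self hr0⟩)
  intro f hf f' hf' hne
  refine Set.disjoint_left.2 fun H hH hH' => hne (funext fun k => ?_)
  have hd : dist (G f) (G f') < 2 * r := by
    have := dist_triangle_right (G f) (G f') H
    rw [Metric.mem_ball'] at hH hH'
    linarith
  have hlt : |f k - f' k| < 2 := by
    rw [hG f hf k, hG f' hf' k, ← Finset.sum_sub_distrib]
    calc _ ≤ ∑ i, |G f i ⟨φ i k, hφ i k⟩ - G f' i ⟨φ i k, hφ i k⟩| :=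
          Finset.abs_sum_le_sum_abs _ _
      _ ≤ ∑ _i : Fin n, 2 * r := Finset.sum_le_sum fun i _ =>
          (Real.dist_eq _ _).symm.le.trans
            (((ContinuousMap.dist_apply_le_dist _).trans (dist_le_pi_dist _ _ i)).trans hd.le)
      _ < 2 := by
          simp only [Finset.sum_const, Finset.card_univ, Fintype.card_fin, nsmul_eq_mul, hr]
          rw [← mul_assoc, mul_one_div, div_lt_iff₀ (by positivity)]
          linarith
  have h1 : f k ∈ ({-1, 1} : Set ℝ) := hf.1 ▸ Set.mem_range_self k
  have h2 : f' k ∈ ({-1, 1} : Set ℝ) := hf'.1 ▸ Set.mem_range_self k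
  rcases h1 with h1 | h1 <;> rcases h2 with h2 | h2 <;> rw [h1, h2] at hlt ⊢ <;>
    norm_num at hlt

lemma mk_nat_to_real : #(ℕ → ℝ) = 𝔠 := by
  simp [Cardinal.mk_real]

lemma mk_range_pair : #({ f : ℕ → ℝ | Set.range f = {-1, 1} } : Set (ℕ → ℝ)) = 𝔠 := by
  refine le_antisymm ((Cardinal.mk_set_le _).trans mk_nat_to_real.le) ?_
  have hB : #(ℕ → Bool) = 𝔠 := by simp
  rw [← hB]
  let F : (ℕ → Bool) → ℕ → ℝ := fun b k =>
    Nat.casesOn k 1 fun k => Nat.casesOn k (-1) fun k => if b k then 1 else -1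
  have hF : ∀ b, Set.range (F b) = {-1, 1} := by
    intro b
    ext x
    constructor
    · rintro ⟨_ | _ | k, rfl⟩
      · simp [F]
      · simp [F]
      · by_cases h : b k <;> simp [F, h]
    · rintro (rfl | rfl)
      · exact ⟨1, rfl⟩
      · exact ⟨0, rfl⟩
  refine Cardinal.mk_le_of_injective (f := fun b => ⟨F b, hF b⟩) fun b b' h => ?_
  funext k
  have hk : F b (k + 2) = F b' (k + 2) := congrFun (Subtype.ext_iff.1 h) (k + 2)
  cases h1 : b k <;> cases h2 : b' k <;> simp [F, h1, h2] at hk ⊢ <;> norm_num at hk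

lemma IsBasicNatIcc.continuum_le_mk {Φ : Set (ℕ → ℝ)} (hΦ : IsBasicNatIcc Φ) : 𝔠 ≤ #Φ := by
  by_contra! hlt
  let T : (Σ m, Fin m → Φ) → Set (ℕ → ℝ) := fun p =>
    ({ f : ℕ → ℝ | Set.range f = {-1, 1} } : Set (ℕ → ℝ)) ∩
      { f : ℕ → ℝ | ∃ g : Fin p.1 → C(ℝ, ℝ), ∀ k, f k = ∑ i, g i ((p.2 i : ℕ → ℝ) k) }
  have hT : ∀ p, #(T p) ≤ ℵ₀ := fun p => (countable_range_pair_inter_sums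
    (fun i => (p.2 i : ℕ → ℝ)) fun i k => hΦ.1 _ (p.2 i).2 k).le_aleph0
  have hsub : { f : ℕ → ℝ | Set.range f = {-1, 1} } ⊆ ⋃ p, T p := by
    intro f hf
    have hfk : ∀ k, f k ∈ Set.Icc (-1:ℝ) 1 := by
      intro k
      have h : f k ∈ ({-1, 1} : Set ℝ) := hf ▸ Set.mem_range_self k
      rcases h with h | h <;> rw [h] <;> norm_num
    obtain ⟨m, φ, g, hφ, hg⟩ := hΦ.2 f hfk
    exact Set.mem_iUnion.2 ⟨⟨m, fun i => ⟨φ i, hφ i⟩⟩, hf, g, hg⟩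
  have hidx : #(Σ m, Fin m → Φ) < 𝔠 := by
    rw [← Cardinal.mk_congr (List.equivSigmaTuple (α := Φ))]
    exact (Cardinal.mk_list_le_max Φ).trans_lt (max_lt Cardinal.aleph0_lt_continuum hlt)
  have hle : 𝔠 ≤ #(Σ m, Fin m → Φ) * ℵ₀ := by
    rw [← mk_range_pair]
    exact (Cardinal.mk_le_mk_of_subset hsub).trans ((Cardinal.mk_iUnion_le _).trans
      (mul_le_mul_right (ciSup_le' hT) _))
  exact hle.not_gt
    (Cardinal.mul_lt_of_lt Cardinal.aleph0_le_continuum hidx Cardinal.aleph0_lt_continuum)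

lemma isBasicNatIcc_setOf_mem_Icc :
    IsBasicNatIcc { f : ℕ → ℝ | ∀ k, f k ∈ Set.Icc (-1:ℝ) 1 } :=
  ⟨fun _ h => h, fun f hf => ⟨1, fun _ => f, fun _ => ContinuousMap.id ℝ, fun _ => hf,
    fun k => by simp⟩⟩

lemma basicNatIcc_eq_continuum : basicNatIcc = 𝔠 := by
  have hmem : #{ f : ℕ → ℝ | ∀ k, f k ∈ Set.Icc (-1:ℝ) 1 } ∈
      { c | ∃ Φ : Set (ℕ → ℝ), IsBasicNatIcc Φ ∧ #Φ = c } :=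
    ⟨_, isBasicNatIcc_setOf_mem_Icc, rfl⟩
  refine le_antisymm ?_ (le_csInf ⟨_, hmem⟩ ?_)
  · exact (csInf_le' hmem).trans ((Cardinal.mk_set_le _).trans mk_nat_to_real.le)
  · rintro _ ⟨Φ, hΦ, rfl⟩
    exact hΦ.continuum_le_mk

theorem stmt9 :
    #({ f : ℕ → ℝ | Set.range f = {-1, 1} } : Set (ℕ → ℝ)) = 𝔠 ∧
    (∀ n : ℕ, 1 ≤ n → ∀ φ : Fin n → (ℕ → ℝ), (∀ i k, φ i k ∈ Set.Icc (-1:ℝ) 1) →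
      (({ f : ℕ → ℝ | Set.range f = {-1, 1} } : Set (ℕ → ℝ)) ∩
        { f : ℕ → ℝ | ∃ g : Fin n → C(ℝ, ℝ), ∀ k, f k = ∑ i, g i (φ i k) }).Countable) ∧
    basicNatIcc = 𝔠 :=
  ⟨mk_range_pair, fun _ _ φ hφ => countable_range_pair_inter_sums φ hφ, basicNatIcc_eq_continuum⟩

end
end

section
/- Suppose K is a compact Hausdorff space of uncountable weight with dim K ≤ n for some n ∈ ℕ. Then basic(K) ≤ cof([w(K)]^ℵ0, ⊆). -/
open Cardinal Set Topology

noncomputable section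

/-- A finite open cover of a normal space carries a partition of unity of the same index. -/
theorem exists_finite_partitionOfUnity {X ι : Type*} [TopologicalSpace X] [NormalSpace X]
    [Fintype ι] (U : ι → Set X) (hU : ∀ i, IsOpen (U i)) (hc : ∀ x, ∃ i, x ∈ U i) :
    ∃ f : ι → C(X, ℝ), (∀ i x, 0 ≤ f i x) ∧ (∀ x, ∑ i, f i x = 1) ∧
      ∀ i x, x ∉ U i → f i x = 0 := by
  obtain ⟨p, hp⟩ := PartitionOfUnity.exists_isSubordinate_of_locallyFinite isClosed_univ U hU
    (locallyFinite_of_finite U) (fun x _ => mem_iUnion.2 (hc x))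
  refine ⟨fun i => p i, fun i x => p.nonneg i x, fun x => ?_, fun i x hx => ?_⟩
  · rw [← finsum_eq_sum_of_fintype]
    exact p.sum_eq_one (mem_univ x)
  · by_contra h
    exact hx (hp i (subset_tsupport _ h))

/-- The barycentric-type coordinates of a vector: its entries, followed by minus their sum. -/
def simplexCoord {n : ℕ} (v : EuclideanSpace ℝ (Fin (n + 1))) (i : Fin (n + 2)) : ℝ :=
  Fin.lastCases (motive := fun _ => ℝ) (-∑ j, v j) (fun j => v j) i

theorem continuous_simplexCoord {n : ℕ} (i : Fin (n + 2)) :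
    Continuous fun v : EuclideanSpace ℝ (Fin (n + 1)) => simplexCoord v i := by
  induction i using Fin.lastCases with
  | last => simp only [simplexCoord, Fin.lastCases_last]; fun_prop
  | cast j => simp only [simplexCoord, Fin.lastCases_castSucc]; fun_prop

theorem sum_simplexCoord {n : ℕ} (v : EuclideanSpace ℝ (Fin (n + 1))) :
    ∑ i, simplexCoord v i = 0 := by
  simp [Fin.sum_univ_castSucc, simplexCoord]

theorem eq_zero_of_simplexCoord {n : ℕ} {v : EuclideanSpace ℝ (Fin (n + 1))}
    (h : ∀ i, simplexCoord v i = 0) : v = 0 := by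
  ext j
  simpa [simplexCoord] using h j.castSucc

theorem simplexCoord_smul {n : ℕ} (c : ℝ) (v : EuclideanSpace ℝ (Fin (n + 1)))
    (i : Fin (n + 2)) : simplexCoord (c • v) i = c * simplexCoord v i := by
  induction i using Fin.lastCases with
  | last => simp [simplexCoord, Finset.mul_sum]
  | cast j => simp [simplexCoord]

theorem simplexCoord_toLp {n : ℕ} (w : Fin (n + 2) → ℝ) (hw : ∑ i, w i = 0) (i : Fin (n + 2)) :
    simplexCoord (WithLp.toLp 2 fun j : Fin (n + 1) => w j.castSucc) i = w i := by
  induction i using Fin.lastCases with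
  | last =>
    rw [Fin.sum_univ_castSucc] at hw
    simp only [simplexCoord, Fin.lastCases_last]
    linarith
  | cast j => simp [simplexCoord]

/-- In a normal space of dimension at most `n`, an open cover by `n + 2` sets has an open
shrinking with empty intersection. -/
theorem DimLE.exists_shrinking_fin {X : Type u} [TopologicalSpace X] [NormalSpace X] {n : ℕ}
    (hdim : DimLE X n) (U : Fin (n + 2) → Set X) (hU : ∀ i, IsOpen (U i))
    (hc : ∀ x, ∃ i, x ∈ U i) :
    ∃ W : Fin (n + 2) → Set X, (∀ i, IsOpen (W i)) ∧ (∀ i, W i ⊆ U i) ∧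
      (∀ x, ∃ i, x ∈ W i) ∧ ∀ x, ∃ i, x ∉ W i := by
  obtain ⟨f, f0, f1, fU⟩ := exists_finite_partitionOfUnity U hU hc
  let A : Set X := {x | ∃ i, f i x = 0}
  have hA : IsClosed A := by
    have : A = ⋃ i, {x | f i x = 0} := by ext; simp [A]
    rw [this]
    exact isClosed_iUnion_of_finite fun i => isClosed_eq (f i).continuous continuous_const
  let w : X → Fin (n + 2) → ℝ := fun x i => f i x - 1 / (n + 2)
  have hw : ∀ x, ∑ i, w x i = 0 := by
    intro x
    simp only [w, Finset.sum_sub_distrib, f1]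
    have : ((n : ℝ) + 2) ≠ 0 := by positivity
    simp
    field_simp
    simp
  let h : X → EuclideanSpace ℝ (Fin (n + 1)) := fun x => WithLp.toLp 2 fun j => w x j.castSucc
  have hh : Continuous h := by
    simp only [h, w]
    fun_prop
  have hcoord : ∀ x i, simplexCoord (h x) i = w x i := fun x i => simplexCoord_toLp _ (hw x) i
  have hne : ∀ x ∈ A, h x ≠ 0 := by
    rintro x ⟨i, hi⟩ h0
    have h2 := hcoord x i
    have : ((n : ℝ) + 2) > 0 := by positivity
    have h3 : simplexCoord (h x) i = 0 := by
      have := simplexCoord_smul 0 (h x) i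
      rw [zero_smul, ← h0, zero_mul] at this
      exact this
    simp only [h3, w, hi] at h2
    have : (1 : ℝ) / (n + 2) > 0 := by positivity
    linarith
  obtain ⟨G, hG⟩ := hdim A hA
    ⟨fun a => ⟨‖h a‖⁻¹ • h a, by
      have := norm_ne_zero_iff.2 (hne a a.2)
      simp [norm_smul, this]⟩, by
      refine Continuous.subtype_mk ?_ _
      have hc' : Continuous fun a : A => h a := hh.comp continuous_subtype_val
      exact (hc'.norm.inv₀ fun a => norm_ne_zero_iff.2 (hne a a.2)).smul hc'⟩
  let ℓ : Fin (n + 2) → X → ℝ := fun i x => simplexCoord (G x : EuclideanSpace ℝ _) i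
  have hℓ : ∀ i, Continuous (ℓ i) := fun i =>
    (continuous_simplexCoord i).comp (continuous_subtype_val.comp G.continuous)
  refine ⟨fun i => {x | ∃ j, ℓ j x < ℓ i x}, fun i => ?_, fun i x hx => ?_, fun x => ?_,
    fun x => ?_⟩
  · simp only [ofPred_exists]
    exact isOpen_iUnion fun j => isOpen_lt (hℓ j) (hℓ i)
  · by_contra hxU
    have hfi := fU i x hxU
    have hxA : x ∈ A := ⟨i, hfi⟩
    obtain ⟨j, hj⟩ := hx
    have e : ∀ j, ℓ j x = ‖h x‖⁻¹ * w x j := by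
      intro j
      have := hG ⟨x, hxA⟩
      simp only [ℓ]
      rw [this]
      simp [simplexCoord_smul, hcoord]
    rw [e, e] at hj
    have hpos : 0 < ‖h x‖⁻¹ := inv_pos.2 (norm_pos_iff.2 (hne x hxA))
    have := lt_of_mul_lt_mul_left hj hpos.le
    have := f0 j x
    simp only [w, hfi] at *
    linarith
  · by_contra! hcon
    simp only [mem_ofPred_eq, not_exists, not_lt] at hcon
    have heq : ∀ i j, ℓ i x = ℓ j x := fun i j => le_antisymm (hcon i j) (hcon j i)
    have hs : ∑ i, ℓ i x = 0 := sum_simplexCoord _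
    have h0 : ∀ i, ℓ i x = 0 := by
      intro i
      rw [Finset.sum_congr rfl fun j _ => heq j i] at hs
      simp only [Finset.sum_const, Finset.card_univ, Fintype.card_fin, nsmul_eq_mul] at hs
      rcases mul_eq_zero.1 hs with h | h
      · exact absurd h (by positivity)
      · exact h
    have hz := eq_zero_of_simplexCoord h0
    have := (G x).2
    rw [hz] at this
    simp at this
  · obtain ⟨i, hi⟩ := Finite.exists_min fun i => ℓ i x
    exact ⟨i, fun ⟨j, hj⟩ => (hi j).not_gt hj⟩

/-- A normal space of dimension at most `n` has covering dimension at most `n`. -/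
theorem DimLE.exists_shrinking {X : Type u} [TopologicalSpace X] [NormalSpace X] {n : ℕ}
    (hdim : DimLE X n) {ι : Type*} [Finite ι] (U : ι → Set X) (hU : ∀ i, IsOpen (U i))
    (hc : ∀ x, ∃ i, x ∈ U i) :
    ∃ V : ι → Set X, (∀ i, IsOpen (V i)) ∧ (∀ i, V i ⊆ U i) ∧ (∀ x, ∃ i, x ∈ V i) ∧
      ∀ x, {i | x ∈ V i}.ncard ≤ n + 1 := by
  classical
  have := Fintype.ofFinite ι
  have key : ∀ R : Finset (ι → Fin (n + 2)), ∃ V : ι → Set X, (∀ i, IsOpen (V i)) ∧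
      (∀ i, V i ⊆ U i) ∧ (∀ x, ∃ i, x ∈ V i) ∧
      ∀ r ∈ R, ∀ x, ∃ m, ∀ i, r i = m → x ∉ V i := by
    intro R
    induction R using Finset.induction_on with
    | empty => exact ⟨U, hU, fun _ => Subset.rfl, hc, by simp⟩
    | insert r R _ ih =>
      obtain ⟨V, Vo, VU, Vc, VR⟩ := ih
      obtain ⟨W, Wo, WV, Wc, We⟩ := hdim.exists_shrinking_fin
        (fun m => ⋃ (i) (_ : r i = m), V i)
        (fun m => isOpen_iUnion fun i => isOpen_iUnion fun _ => Vo i)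
        (fun x => (Vc x).elim fun i hi => ⟨r i, by simpa using ⟨i, rfl, hi⟩⟩)
      refine ⟨fun i => V i ∩ W (r i), fun i => (Vo i).inter (Wo _),
        fun i => inter_subset_left.trans (VU i), fun x => ?_, fun s hs x => ?_⟩
      · obtain ⟨m, hm⟩ := Wc x
        obtain ⟨i, hi, hx⟩ : ∃ i, r i = m ∧ x ∈ V i := by simpa using WV m hm
        exact ⟨i, hx, hi ▸ hm⟩
      · rcases Finset.mem_insert.1 hs with rfl | hs
        · obtain ⟨m, hm⟩ := We x
          exact ⟨m, fun i hi hx => hm (hi ▸ hx.2)⟩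
        · obtain ⟨m, hm⟩ := VR s hs x
          exact ⟨m, fun i hi hx => hm i hi hx.1⟩
  obtain ⟨V, Vo, VU, Vc, VR⟩ := key Finset.univ
  refine ⟨V, Vo, VU, Vc, fun x => ?_⟩
  by_contra! hcard
  obtain ⟨e⟩ : Nonempty (Fin (n + 2) ↪ {i | x ∈ V i}) := by
    refine Function.Embedding.nonempty_of_card_le ?_
    rw [Fintype.card_fin, ← Nat.card_eq_fintype_card, Nat.card_coe_set_eq]
    omega
  have hinj : Function.Injective fun m => (e m : ι) := Subtype.val_injective.comp e.injective
  obtain ⟨m, hm⟩ := VR (Function.invFun fun m => (e m : ι)) (Finset.mem_univ _) x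
  exact hm (e m) (Function.leftInverse_invFun hinj m) (e m).2

/-- In a compact space of dimension at most `n`, given finitely many continuous functions, there
are `N` finite disjoint families of closed sets on which these functions oscillate little, such
that every point is missed by at most `n + 1` of the families. -/
theorem DimLE.exists_families {X : Type u} [TopologicalSpace X] [CompactSpace X] [T2Space X]
    {n : ℕ} (hdim : DimLE X n) {τ : Type*} [Finite τ] (a : τ → C(X, ℝ)) {ε : ℝ} (hε : 0 < ε)
    (N : ℕ) :
    ∃ (ι : Type u) (_ : Finite ι) (D : Fin N → ι → Set X), (∀ j s, IsClosed (D j s)) ∧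
      (∀ j, Pairwise fun s s' => Disjoint (D j s) (D j s')) ∧
      (∀ x, {j | ∀ s, x ∉ D j s}.ncard ≤ n + 1) ∧
      ∀ t j s, ∀ x ∈ D j s, ∀ y ∈ D j s, |a t x - a t y| ≤ ε := by
  classical
  obtain ⟨F, hF⟩ := isCompact_univ.elim_finite_subcover
    (fun z : X => {x | ∀ t, |a t x - a t z| < ε / 2})
    (fun z => by
      simp only [ofPred_forall]
      exact isOpen_iInter_of_finite fun t => isOpen_lt (by fun_prop) continuous_const)
    (fun x _ => mem_iUnion.2 ⟨x, by intro t; simpa using hε⟩)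
  obtain ⟨V, Vo, VU, Vc, Vn⟩ := hdim.exists_shrinking
    (fun z : F => {x | ∀ t, |a t x - a t z| < ε / 2})
    (fun z => by
      simp only [ofPred_forall]
      exact isOpen_iInter_of_finite fun t => isOpen_lt (by fun_prop) continuous_const)
    (fun x => by
      obtain ⟨z, hz, hx⟩ := mem_iUnion₂.1 (hF (mem_univ x))
      exact ⟨⟨z, hz⟩, hx⟩)
  obtain ⟨f, f0, f1, fV⟩ := exists_finite_partitionOfUnity V Vo Vc
  have hsupp : ∀ x i, 0 < f i x → i ∈ {i | x ∈ V i} := by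
    intro x i hi
    by_contra h
    exact hi.ne' (fV i x h)
  rcases Nat.eq_zero_or_pos N with rfl | hN
  · exact ⟨PEmpty, inferInstance, fun j => j.elim0, fun j => j.elim0, fun j => j.elim0,
      fun x => by simp [Set.eq_empty_of_isEmpty], fun t j => j.elim0⟩
  have hNR : (0 : ℝ) < N := by exact_mod_cast hN
  obtain ⟨d, hd0, hd⟩ : ∃ d : ℝ, 0 < d ∧ (n + 1) * (N * d) = 1 :=
    ⟨1 / ((n + 1) * N), by positivity, by field_simp⟩
  refine ⟨Finset F, inferInstance, fun j S => {x | S.Nonempty ∧ (∀ i ∈ S, (j + 1) * d ≤ f i x) ∧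
    ∀ i ∉ S, f i x ≤ j * d}, fun j S => ?_, fun j S S' hS => ?_, fun x => ?_, ?_⟩
  · simp only [ofPred_and, ofPred_forall]
    refine isClosed_const.inter (IsClosed.inter ?_ ?_)
    · exact isClosed_biInter fun i _ => isClosed_le continuous_const (f i).continuous
    · exact isClosed_biInter fun i _ => isClosed_le (f i).continuous continuous_const
  · refine Set.disjoint_left.2 ?_
    rintro x ⟨-, h1, h2⟩ ⟨-, h3, h4⟩
    apply hS
    ext i
    constructor
    · intro hi
      by_contra hi'
      linarith [h1 i hi, h4 i hi']
    · intro hi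
      by_contra hi'
      linarith [h3 i hi, h2 i hi']
  · have hbad : ∀ j ∈ {j : Fin N | ∀ S : Finset F, x ∉ {x | S.Nonempty ∧
        (∀ i ∈ S, (j + 1) * d ≤ f i x) ∧ ∀ i ∉ S, f i x ≤ j * d}},
        ∃ i, j * d < f i x ∧ f i x < (j + 1) * d := by
      intro j hj
      by_contra! hcon
      refine hj (Finset.univ.filter fun i => j * d < f i x) ⟨?_, ?_, ?_⟩
      · by_contra hne
        rw [Finset.not_nonempty_iff_eq_empty, Finset.filter_eq_empty_iff] at hne
        have h1 : ∑ i, f i x ≤ (n + 1) * (j * d) := by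
          have hsub : ∑ i, f i x = ∑ i ∈ Finset.univ.filter (fun i => x ∈ V i), f i x := by
            symm
            refine Finset.sum_subset (Finset.subset_univ _) fun i _ hi => fV i x ?_
            simpa using hi
          rw [hsub]
          refine (Finset.sum_le_card_nsmul _ _ (j * d)
            fun i _ => not_lt.1 (hne (Finset.mem_univ i))).trans ?_
          rw [nsmul_eq_mul]
          refine mul_le_mul_of_nonneg_right ?_ (by positivity)
          have := Vn x
          rw [Set.ncard_eq_toFinset_card'] at this
          simp only [Set.toFinset_ofPred] at this
          exact_mod_cast this
        rw [f1] at h1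
        have hj' : (j : ℝ) < N := by exact_mod_cast j.2
        have : (j : ℝ) * d < N * d := mul_lt_mul_of_pos_right hj' hd0
        nlinarith [mul_lt_mul_of_pos_left this (by positivity : (0 : ℝ) < n + 1)]
      · intro i hi
        exact hcon i (Finset.mem_filter.1 hi).2
      · intro i hi
        simpa using hi
    have : Nonempty F := ⟨(Vc x).choose⟩
    choose! c hc1 hc2 using hbad
    refine (Set.ncard_le_ncard_of_injOn c (fun j hj => hsupp x _
      ((mul_nonneg (Nat.cast_nonneg _) hd0.le).trans_lt (hc1 j hj))) (fun j hj j' hj' h => ?_)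
      (Set.toFinite _)).trans (Vn x)
    have l1 := hc1 j hj
    have l2 := hc2 j hj
    have l3 := hc1 j' hj'
    have l4 := hc2 j' hj'
    rw [← h] at l3 l4
    have m1 := lt_of_mul_lt_mul_right (l1.trans l4) hd0.le
    have m2 := lt_of_mul_lt_mul_right (l3.trans l2) hd0.le
    norm_cast at m1 m2
    exact Fin.ext (by omega)
  · rintro t j S x ⟨⟨i, hi⟩, hx, -⟩ y ⟨-, hy, -⟩
    have hj : 0 < ((j : ℝ) + 1) * d := by positivity
    have ux := VU i (hsupp x i (hj.trans_le (hx i hi))) t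
    have uy := VU i (hsupp y i (hj.trans_le (hy i hi))) t
    rw [abs_lt] at ux uy
    rw [abs_le]
    constructor <;> linarith

/-- Simultaneous Tietze extension from finitely many disjoint closed sets. -/
theorem exists_extension_of_disjoint {X ι : Type*} [TopologicalSpace X] [NormalSpace X]
    [Finite ι] (D : ι → Set X) (hD : ∀ s, IsClosed (D s))
    (hdis : Pairwise fun s s' => Disjoint (D s) (D s')) (v : ι → C(X, ℝ)) {δ : ℝ} (hδ : 0 ≤ δ)
    (hv : ∀ s, ∀ x ∈ D s, |v s x| ≤ δ) :
    ∃ u : C(X, ℝ), (∀ x, |u x| ≤ δ) ∧ ∀ s, ∀ x ∈ D s, u x = v s x := by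
  classical
  let F : X → ℝ := fun x => if h : ∃ s, x ∈ D s then v h.choose x else 0
  have hF : ∀ s, ∀ x ∈ D s, F x = v s x := by
    intro s x hx
    have h : ∃ s, x ∈ D s := ⟨s, hx⟩
    have : h.choose = s := by
      by_contra hne
      exact Set.disjoint_left.1 (hdis hne) h.choose_spec hx
    simp only [F, dif_pos h, this]
  have hFc : ContinuousOn F (⋃ s, D s) :=
    (locallyFinite_of_finite D).continuousOn_iUnion hD fun s =>
      (v s).continuous.continuousOn.congr fun x hx => hF s x hx
  obtain ⟨u, hu, hur⟩ := ContinuousMap.exists_restrict_eq_forall_mem_of_closed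
    (⟨_, hFc.domRestrict⟩ : C((⋃ s, D s : Set X), ℝ)) (t := Icc (-δ) δ)
    (fun x => by
      obtain ⟨s, hs⟩ := mem_iUnion.1 x.2
      have := hv s x hs
      simp only [ContinuousMap.coe_mk, Set.domRestrict_apply, hF s x hs]
      exact abs_le.1 this)
    ⟨0, by simpa using hδ⟩ (isClosed_iUnion_of_finite hD)
  refine ⟨u, fun x => abs_le.2 (hu x), fun s x hx => ?_⟩
  have := DFunLike.congr_fun hur (⟨x, mem_iUnion.2 ⟨s, hx⟩⟩ : (⋃ s, D s : Set X))
  rw [← hF s x hx]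
  exact this

/-- A finite family of reals can be made injective by an arbitrarily small perturbation. -/
theorem exists_injective_near {ι : Type*} [Finite ι] (p : ι → ℝ) {δ : ℝ} (hδ : 0 < δ) :
    ∃ c : ι → ℝ, Function.Injective c ∧ ∀ s, |c s - p s| ≤ δ := by
  obtain ⟨m, ⟨e⟩⟩ := Finite.exists_equiv_fin ι
  let bad : Set ℝ := ⋃ q ∈ {q : ι × ι | q.1 ≠ q.2}, {t | p q.1 + t * e q.1 = p q.2 + t * e q.2}
  have hbad : bad.Finite := by
    refine Set.Finite.biUnion (Set.toFinite _) fun q hq => Set.Subsingleton.finite ?_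
    intro t ht t' ht'
    simp only [mem_ofPred_eq] at ht ht' hq
    have hne : ((e q.1 : ℕ) : ℝ) - (e q.2 : ℕ) ≠ 0 := by
      rw [sub_ne_zero]
      exact_mod_cast fun h => hq (e.injective (Fin.ext h))
    have h0 : (t - t') * (((e q.1 : ℕ) : ℝ) - (e q.2 : ℕ)) = 0 := by linear_combination ht - ht'
    exact sub_eq_zero.1 ((mul_eq_zero.1 h0).resolve_right hne)
  have hm : (0 : ℝ) < m + 1 := by positivity
  obtain ⟨t, ⟨ht0, ht1⟩, ht⟩ :=
    ((Set.Ioo_infinite (div_pos hδ hm)).sdiff hbad).nonempty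
  refine ⟨fun s => p s + t * e s, fun s s' h => ?_, fun s => ?_⟩
  · by_contra hne
    exact ht (mem_iUnion₂.2 ⟨(s, s'), hne, h⟩)
  · have h1 : ((e s : ℕ) : ℝ) ≤ m + 1 := by
      have : (e s : ℕ) ≤ m + 1 := by omega
      exact_mod_cast this
    rw [add_sub_cancel_left, abs_of_nonneg (by positivity)]
    calc t * (e s : ℕ) ≤ δ / (m + 1) * (m + 1) := by gcongr
      _ = δ := by field_simp

/-- If every function in a class is approximated, with a relative error `3 / 4`, by sums of
superpositions whose subtraction stays in the class, then it is such a sum. -/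
theorem exists_eq_sum_comp {X : Type*} [TopologicalSpace X] [CompactSpace X] {N : ℕ}
    (φ : Fin N → C(X, ℝ)) (A : Set C(X, ℝ))
    (hA : ∀ f ∈ A, ∃ g : Fin N → C(ℝ, ℝ), (∀ j y, |g j y| ≤ ‖f‖) ∧
      f - ∑ j, (g j).comp (φ j) ∈ A ∧ ‖f - ∑ j, (g j).comp (φ j)‖ ≤ 3 / 4 * ‖f‖)
    {f : C(X, ℝ)} (hf : f ∈ A) :
    ∃ g : Fin N → C(ℝ, ℝ), ∀ x, f x = ∑ j, g j (φ j x) := by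
  choose! g g1 g2 g3 using hA
  let T : C(X, ℝ) → C(X, ℝ) := fun f => f - ∑ j, (g f j).comp (φ j)
  let F : ℕ → C(X, ℝ) := fun k => T^[k] f
  have hFs : ∀ k, F (k + 1) = F k - ∑ j, (g (F k) j).comp (φ j) := fun k =>
    Function.iterate_succ_apply' T k f
  have hF : ∀ k, F k ∈ A := by
    intro k
    induction k with
    | zero => exact hf
    | succ k ih => rw [hFs]; exact g2 _ ih
  have hn : ∀ k, ‖F k‖ ≤ (3 / 4) ^ k * ‖f‖ := by
    intro k
    induction k with
    | zero => simp [F]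
    | succ k ih =>
      rw [hFs]
      refine (g3 _ (hF k)).trans ?_
      rw [pow_succ]
      linarith
  have hsum : Summable fun k : ℕ => (3 / 4 : ℝ) ^ k * ‖f‖ :=
    (summable_geometric_of_lt_one (by norm_num) (by norm_num)).mul_right _
  have hb : ∀ j k y, ‖g (F k) j y‖ ≤ (3 / 4) ^ k * ‖f‖ := fun j k y =>
    (g1 _ (hF k) j y).trans (hn k)
  refine ⟨fun j => ⟨fun y => ∑' k, g (F k) j y,
    continuous_tsum (fun k => (g (F k) j).continuous) hsum (hb j)⟩, fun x => ?_⟩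
  have hs : HasSum (fun k => ∑ j, g (F k) j (φ j x)) (∑ j, ∑' k, g (F k) j (φ j x)) :=
    hasSum_sum fun j _ => (Summable.of_norm_bounded hsum fun k => hb j k _).hasSum
  have hpart : ∀ m, ∑ k ∈ Finset.range m, ∑ j, g (F k) j (φ j x) = f x - F m x := by
    intro m
    rw [← show F 0 x = f x from rfl, ← Finset.sum_range_sub' fun k => F k x]
    refine Finset.sum_congr rfl fun k _ => ?_
    simp [hFs]
  have hlim : Filter.Tendsto (fun m => f x - F m x) Filter.atTop (𝓝 (f x - 0)) := by
    refine tendsto_const_nhds.sub ?_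
    refine squeeze_zero_norm (fun m => ((F m).norm_coe_le_norm x).trans (hn m)) ?_
    exact hsum.tendsto_atTop_zero
  have := hs.tendsto_sum_nat
  simp only [hpart] at this
  have := tendsto_nhds_unique hlim this
  simpa using this

/-- Functions whose oscillation on the members of the `k`-th families tends to zero. -/
def FineOn {X : Type*} [TopologicalSpace X] {N : ℕ} {ι : ℕ → Type*}
    (D : ∀ k, Fin N → ι k → Set X) : Set C(X, ℝ) :=
  {f | ∀ ε > 0, ∃ k₀, ∀ k ≥ k₀, ∀ j s, ∀ x ∈ D k j s, ∀ y ∈ D k j s, |f x - f y| ≤ ε}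

theorem FineOn.sub {X : Type*} [TopologicalSpace X] {N : ℕ} {ι : ℕ → Type*}
    {D : ∀ k, Fin N → ι k → Set X} {f g : C(X, ℝ)} (hf : f ∈ FineOn D) (hg : g ∈ FineOn D) :
    f - g ∈ FineOn D := by
  intro ε hε
  obtain ⟨k₁, h₁⟩ := hf (ε / 2) (half_pos hε)
  obtain ⟨k₂, h₂⟩ := hg (ε / 2) (half_pos hε)
  refine ⟨max k₁ k₂, fun k hk j s x hx y hy => ?_⟩
  have a1 := abs_le.1 (h₁ k (le_of_max_le_left hk) j s x hx y hy)
  have a2 := abs_le.1 (h₂ k (le_of_max_le_right hk) j s x hx y hy)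
  simp only [ContinuousMap.sub_apply]
  rw [abs_le]
  constructor <;> linarith [a1.1, a1.2, a2.1, a2.2]

theorem FineOn.sum {X : Type*} [TopologicalSpace X] {N : ℕ} {ι : ℕ → Type*}
    {D : ∀ k, Fin N → ι k → Set X} {τ : Type*} (t : Finset τ) (f : τ → C(X, ℝ))
    (hf : ∀ i ∈ t, f i ∈ FineOn D) : ∑ i ∈ t, f i ∈ FineOn D := by
  have h0 : (0 : C(X, ℝ)) ∈ FineOn D := fun ε hε => ⟨0, by simp [hε.le]⟩
  refine Finset.sum_induction f (· ∈ FineOn D) (fun a b ha hb => ?_) h0 hf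
  have := FineOn.sub ha (FineOn.sub h0 hb)
  simpa using this

theorem FineOn.comp {X : Type*} [TopologicalSpace X] [CompactSpace X] {N : ℕ} {ι : ℕ → Type*}
    {D : ∀ k, Fin N → ι k → Set X} (g : C(ℝ, ℝ)) {f : C(X, ℝ)} (hf : f ∈ FineOn D) :
    g.comp f ∈ FineOn D := by
  intro ε hε
  have hu := (isCompact_range f.continuous).uniformContinuousOn_of_continuous
    g.continuous.continuousOn
  obtain ⟨δ, hδ, h⟩ := Metric.uniformContinuousOn_iff.1 hu ε hε
  obtain ⟨k₀, hk⟩ := hf (δ / 2) (half_pos hδ)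
  refine ⟨k₀, fun k hk' j s x hx y hy => ?_⟩
  refine (h (f x) (mem_range_self x) (f y) (mem_range_self y) ?_).le
  exact (hk k hk' j s x hx y hy).trans_lt (half_lt_self hδ)

/-- Kolmogorov's superposition argument: if the maps `φ` are fine with respect to families of
sets that they separate, every fine function is a sum of superpositions with the `φ`. -/
theorem FineOn.exists_eq_sum_comp {X : Type*} [TopologicalSpace X] [CompactSpace X] {n : ℕ}
    {ι : ℕ → Type*} [∀ k, Finite (ι k)] {D : ∀ k, Fin (4 * (n + 1)) → ι k → Set X}
    (hD : ∀ k j s, IsClosed (D k j s))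
    (hmiss : ∀ k x, {j | ∀ s, x ∉ D k j s}.ncard ≤ n + 1)
    (φ : Fin (4 * (n + 1)) → C(X, ℝ)) (hφ : ∀ j, φ j ∈ FineOn D)
    (hsep : ∀ k j s s', s ≠ s' → ∀ x ∈ D k j s, ∀ y ∈ D k j s', φ j x ≠ φ j y)
    {f : C(X, ℝ)} (hf : f ∈ FineOn D) :
    ∃ g : Fin (4 * (n + 1)) → C(ℝ, ℝ), ∀ x, f x = ∑ j, g j (φ j x) := by
  classical
  refine _root_.exists_eq_sum_comp φ (FineOn D) (fun f hf => ?_) hf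
  rcases eq_or_ne f 0 with rfl | hf0
  · exact ⟨0, by simp, by simpa using hf, by simp⟩
  have hM : 0 < ‖f‖ := norm_pos_iff.2 hf0
  set M := ‖f‖ with hMdef
  let c : ℝ := 1 / (4 * (n + 1))
  have hc : 0 < c := by positivity
  have hcn : c * (4 * (n + 1)) = 1 := by simp only [c]; field_simp
  have hc1 : c ≤ 1 := by nlinarith [(Nat.cast_nonneg n : (0 : ℝ) ≤ n)]
  obtain ⟨k, hk⟩ := hf (M / 4) (by positivity)
  have hfM : ∀ x, |f x| ≤ M := fun x => f.norm_coe_le_norm x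
  have hval : ∀ j (s : ι k), ∃ v : ℝ, |v| ≤ M ∧ ∀ x ∈ D k j s, |f x - v| ≤ M / 4 := by
    intro j s
    rcases (D k j s).eq_empty_or_nonempty with h | ⟨y, hy⟩
    · exact ⟨0, by simpa using hM.le, by simp [h]⟩
    · exact ⟨f y, hfM y, fun x hx => hk k le_rfl j s x hx y hy⟩
  choose v hv1 hv2 using hval
  have hg : ∀ j, ∃ u : C(ℝ, ℝ), (∀ y, |u y| ≤ c * M) ∧
      ∀ s, ∀ y ∈ φ j '' D k j s, u y = c * v j s := by
    intro j
    obtain ⟨u, hu1, hu2⟩ := exists_extension_of_disjoint (fun s => φ j '' D k j s)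
      (fun s => ((hD k j s).isCompact.image (φ j).continuous).isClosed)
      (fun s s' hss => by
        refine Set.disjoint_left.2 ?_
        rintro _ ⟨x, hx, rfl⟩ ⟨y, hy, hxy⟩
        exact hsep k j s s' hss x hx y hy hxy.symm)
      (fun s => ContinuousMap.const ℝ (c * v j s)) (δ := c * M) (by positivity)
      (fun s x _ => by
        simp only [ContinuousMap.const_apply, abs_mul, abs_of_pos hc]
        exact mul_le_mul_of_nonneg_left (hv1 j s) hc.le)
    exact ⟨u, hu1, fun s y hy => by simpa using hu2 s y hy⟩
  choose g g1 g2 using hg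
  refine ⟨g, fun j y => (g1 j y).trans (mul_le_of_le_one_left hM.le hc1),
    FineOn.sub hf (FineOn.sum _ _ fun j _ => FineOn.comp _ (hφ j)), ?_⟩
  rw [ContinuousMap.norm_le _ (by positivity)]
  intro x
  have hterm : ∀ j, |c * f x - g j (φ j x)| ≤
      c * M / 4 + if ∀ s, x ∉ D k j s then 2 * (c * M) else 0 := by
    intro j
    split_ifs with h
    · have h1 := abs_le.1 (g1 j (φ j x))
      have h2 := abs_le.1 (hfM x)
      have h3 := mul_le_mul_of_nonneg_left h2.1 hc.le
      have h4 := mul_le_mul_of_nonneg_left h2.2 hc.le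
      have : 0 < c * M := by positivity
      rw [abs_le]
      constructor <;> linarith [h1.1, h1.2]
    · push Not at h
      obtain ⟨s, hs⟩ := h
      rw [g2 j s _ (mem_image_of_mem _ hs), ← mul_sub, abs_mul, abs_of_pos hc]
      have := mul_le_mul_of_nonneg_left (hv2 j s x hs) hc.le
      linarith
  have hrepr : (f - ∑ j, (g j).comp (φ j)) x = ∑ j, (c * f x - g j (φ j x)) := by
    rw [Finset.sum_sub_distrib]
    simp only [ContinuousMap.sub_apply, ContinuousMap.coe_sum, Finset.sum_apply,
      ContinuousMap.comp_apply, Finset.sum_const, Finset.card_univ, Fintype.card_fin, nsmul_eq_mul]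
    push_cast
    linear_combination (-f x) * hcn
  rw [hrepr, Real.norm_eq_abs]
  refine (Finset.abs_sum_le_sum_abs _ _).trans ((Finset.sum_le_sum fun j _ => hterm j).trans ?_)
  rw [Finset.sum_add_distrib, ← Finset.sum_filter]
  simp only [Finset.sum_const, Finset.card_univ, Fintype.card_fin, nsmul_eq_mul]
  have hcard : ((Finset.univ.filter fun j => ∀ s, x ∉ D k j s).card : ℝ) ≤ n + 1 := by
    have := hmiss k x
    rw [Set.ncard_eq_toFinset_card'] at this
    simp only [Set.toFinset_ofPred] at this
    exact_mod_cast this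
  have := mul_le_mul_of_nonneg_right hcard (by positivity : 0 ≤ 2 * (c * M))
  push_cast
  have e1 : (4 * ((n : ℝ) + 1)) * (c * M / 4) = M / 4 := by linear_combination (M / 4) * hcn
  have e2 : ((n : ℝ) + 1) * (2 * (c * M)) = M / 2 := by linear_combination (M / 2) * hcn
  linarith

/-- The tuples `φ` for which some admissible finite families are separated by `φ`, with gap `δ`,
while `a 0, …, a k` and the entries of `φ` oscillate little on their members. -/
def separatingTuples {X : Type u} [TopologicalSpace X] (n N : ℕ) (a : ℕ → C(X, ℝ)) (k : ℕ) :
    Set (Fin N → C(X, ℝ)) :=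
  {φ | ∃ (ι : Type u) (_ : Finite ι) (D : Fin N → ι → Set X) (δ : ℝ), 0 < δ ∧
    (∀ j s, IsClosed (D j s)) ∧ (∀ x, {j | ∀ s, x ∉ D j s}.ncard ≤ n + 1) ∧
    (∀ j s s', s ≠ s' → ∀ x ∈ D j s, ∀ y ∈ D j s', δ ≤ |φ j x - φ j y|) ∧
    (∀ i ≤ k, ∀ j s, ∀ x ∈ D j s, ∀ y ∈ D j s, |a i x - a i y| ≤ 1 / (k + 1)) ∧
    ∀ i j s, ∀ x ∈ D j s, ∀ y ∈ D j s, |φ i x - φ i y| ≤ 1 / (k + 1) - δ}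

theorem abs_apply_sub_le_dist {X : Type*} [TopologicalSpace X] [CompactSpace X] {N : ℕ}
    (φ ψ : Fin N → C(X, ℝ)) (j : Fin N) (x : X) : |φ j x - ψ j x| ≤ dist φ ψ :=
  (ContinuousMap.dist_apply_le_dist x).trans (dist_le_pi_dist φ ψ j)

theorem isOpen_separatingTuples {X : Type u} [TopologicalSpace X] [CompactSpace X] (n N : ℕ)
    (a : ℕ → C(X, ℝ)) (k : ℕ) : IsOpen (separatingTuples n N a k) := by
  rw [Metric.isOpen_iff]
  rintro φ ⟨ι, hι, D, δ, hδ, h1, h2, h3, h4, h5⟩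
  refine ⟨δ / 4, by positivity, fun ψ hψ => ⟨ι, hι, D, δ / 2, half_pos hδ, h1, h2,
    fun j s s' hs x hx y hy => ?_, h4, fun i j s x hx y hy => ?_⟩⟩
  · have a1 := abs_le.1 ((abs_apply_sub_le_dist ψ φ j x).trans hψ.le)
    have a2 := abs_le.1 ((abs_apply_sub_le_dist ψ φ j y).trans hψ.le)
    rcases le_abs.1 (h3 j s s' hs x hx y hy) with h | h
    · exact le_abs.2 (Or.inl (by linarith [a1.1, a1.2, a2.1, a2.2]))
    · exact le_abs.2 (Or.inr (by linarith [a1.1, a1.2, a2.1, a2.2]))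
  · have a1 := abs_le.1 ((abs_apply_sub_le_dist ψ φ i x).trans hψ.le)
    have a2 := abs_le.1 ((abs_apply_sub_le_dist ψ φ i y).trans hψ.le)
    have a3 := abs_le.1 (h5 i j s x hx y hy)
    exact abs_le.2 ⟨by linarith [a1.1, a1.2, a2.1, a2.2], by linarith [a1.1, a1.2, a2.1, a2.2]⟩

/-- A finite injective family of reals has a positive gap. -/
theorem exists_gap {ι : Type*} [Finite ι] (c : ι → ℝ) (hc : Function.Injective c) :
    ∃ δ > 0, ∀ s s', s ≠ s' → δ ≤ |c s - c s'| := by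
  have hev : ∀ᶠ δ in 𝓝[>] (0 : ℝ), ∀ s s', s ≠ s' → δ ≤ |c s - c s'| := by
    simp only [Filter.eventually_all]
    intro s s' hs
    have : 0 < |c s - c s'| := abs_pos.2 (sub_ne_zero.2 (hc.ne hs))
    exact ((gt_mem_nhds this).filter_mono nhdsWithin_le_nhds).mono fun _ h => h.le
  obtain ⟨δ, h, hδ⟩ := (hev.and self_mem_nhdsWithin).exists
  exact ⟨δ, hδ, h⟩

theorem DimLE.dense_separatingTuples {X : Type u} [TopologicalSpace X] [CompactSpace X]
    [T2Space X] {n : ℕ} (hdim : DimLE X n) (N : ℕ) (a : ℕ → C(X, ℝ)) (k : ℕ) :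
    Dense (separatingTuples n N a k) := by
  rw [Metric.dense_iff]
  intro φ r hr
  have hk : (0 : ℝ) < 1 / (k + 1) := by positivity
  obtain ⟨η, hη, hηr, hηk⟩ : ∃ η : ℝ, 0 < η ∧ η < r ∧ η ≤ 1 / (k + 1) / 8 :=
    ⟨min (r / 2) (1 / (k + 1) / 8), by positivity,
      (min_le_left _ _).trans_lt (half_lt_self hr), min_le_right _ _⟩
  obtain ⟨ι, hι, D, h1, hdis, h2, hosc⟩ := hdim.exists_families
    (Sum.elim (fun i : Fin (k + 1) => a i) φ) (half_pos hη) N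
  have hp : ∀ j s, ∃ p : ℝ, ∀ x ∈ D j s, |p - φ j x| ≤ η / 2 := by
    intro j s
    rcases (D j s).eq_empty_or_nonempty with h | ⟨y, hy⟩
    · exact ⟨0, by simp [h]⟩
    · exact ⟨φ j y, fun x hx => hosc (Sum.inr j) j s y hy x hx⟩
  choose p hp using hp
  choose c hc hcp using fun j => exists_injective_near (p j) (half_pos hη)
  choose u hu huD using fun j => exists_extension_of_disjoint (D j) (h1 j) (hdis j)
    (fun s => ContinuousMap.const X (c j s) - φ j) hη.le (fun s x hx => by
      have b1 := abs_le.1 (hcp j s)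
      have b2 := abs_le.1 (hp j s x hx)
      simp only [ContinuousMap.sub_apply, ContinuousMap.const_apply]
      exact abs_le.2 ⟨by linarith [b1.1, b2.1], by linarith [b1.2, b2.2]⟩)
  let ψ : Fin N → C(X, ℝ) := fun j => φ j + u j
  have hψD : ∀ j s, ∀ x ∈ D j s, ψ j x = c j s := by
    intro j s x hx
    simp [ψ, huD j s x hx]
  choose δ hδ hgap using fun j => exists_gap (c j) (hc j)
  obtain ⟨δ', hδ', hδk, hδj⟩ : ∃ δ' : ℝ, 0 < δ' ∧ δ' ≤ 1 / ((k : ℝ) + 1) / 2 ∧ ∀ j, δ' ≤ δ j := by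
    have hev : ∀ᶠ t : ℝ in 𝓝[>] 0, t ≤ 1 / ((k : ℝ) + 1) / 2 ∧ ∀ j, t ≤ δ j := by
      refine Filter.Eventually.and ?_ (Filter.eventually_all.2 fun j => ?_)
      · exact ((gt_mem_nhds (half_pos hk)).filter_mono nhdsWithin_le_nhds).mono fun _ h => h.le
      · exact ((gt_mem_nhds (hδ j)).filter_mono nhdsWithin_le_nhds).mono fun _ h => h.le
    obtain ⟨t, ht, h0⟩ := (hev.and self_mem_nhdsWithin).exists
    exact ⟨t, h0, ht⟩
  refine ⟨ψ, ?_, ι, hι, D, δ', hδ', h1, h2, fun j s s' hs x hx y hy => ?_,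
    fun i hi j s x hx y hy => ?_, fun i j s x hx y hy => ?_⟩
  · rw [Metric.mem_ball, dist_pi_lt_iff hr]
    intro j
    refine lt_of_le_of_lt ?_ hηr
    rw [ContinuousMap.dist_le hη.le]
    intro x
    simpa [ψ, Real.dist_eq] using hu j x
  · rw [hψD j s x hx, hψD j s' y hy]
    exact (hδj j).trans (hgap j s s' hs)
  · refine (hosc (Sum.inl ⟨i, Nat.lt_succ_of_le hi⟩) j s x hx y hy).trans ?_
    linarith
  · have b1 := abs_le.1 (hosc (Sum.inr i) j s x hx y hy)
    have b2 := abs_le.1 (hu i x)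
    have b3 := abs_le.1 (hu i y)
    simp only [Sum.elim_inr] at b1
    simp only [ψ, ContinuousMap.add_apply]
    exact abs_le.2 ⟨by linarith [b1.1, b2.1, b3.2], by linarith [b1.2, b2.2, b3.1]⟩

/-- In a compact space of finite dimension, all continuous functions that are controlled by a
given sequence are sums of superpositions with finitely many fixed functions. -/
theorem DimLE.exists_superposition {X : Type u} [TopologicalSpace X] [CompactSpace X]
    [T2Space X] {n : ℕ} (hdim : DimLE X n) (a : ℕ → C(X, ℝ)) :
    ∃ φ : Fin (4 * (n + 1)) → C(X, ℝ), ∀ f : C(X, ℝ),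
      (∀ ε > 0, ∃ T : Finset ℕ, ∀ x y, (∀ i ∈ T, |a i x - a i y| < 1) → |f x - f y| ≤ ε) →
      ∃ g : Fin (4 * (n + 1)) → C(ℝ, ℝ), ∀ x, f x = ∑ j, g j (φ j x) := by
  obtain ⟨φ, hφ⟩ := (dense_iInter_of_isOpen_nat
    (fun k => isOpen_separatingTuples n (4 * (n + 1)) a k)
    fun k => hdim.dense_separatingTuples (4 * (n + 1)) a k).nonempty
  choose ι hι D δ hδ h1 h2 h3 h4 h5 using mem_iInter.1 hφ
  refine ⟨φ, fun f hf => FineOn.exists_eq_sum_comp h1 h2 φ (fun i ε hε => ?_)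
    (fun k j s s' hs x hx y hy hxy => ?_) (fun ε hε => ?_)⟩
  · obtain ⟨k₀, hk₀⟩ := exists_nat_one_div_lt hε
    refine ⟨k₀, fun k hk j s x hx y hy => (h5 k i j s x hx y hy).trans ?_⟩
    have := Nat.one_div_le_one_div (α := ℝ) hk
    linarith [hδ k]
  · have := h3 k j s s' hs x hx y hy
    rw [hxy, sub_self, abs_zero] at this
    exact this.not_gt (hδ k)
  · obtain ⟨T, hT⟩ := hf ε hε
    refine ⟨T.sup id + 1, fun k hk j s x hx y hy => hT x y fun i hi => ?_⟩
    have hik : i ≤ T.sup id := Finset.le_sup (f := id) hi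
    refine (h4 k i (by omega) j s x hx y hy).trans_lt ?_
    rw [div_lt_one (by positivity)]
    have : (1 : ℝ) ≤ k := by exact_mod_cast (by omega : 1 ≤ k)
    linarith

/-- Urysohn functions of pairs of basic open sets control every continuous function. -/
theorem exists_controlling_family {X : Type*} [TopologicalSpace X] [CompactSpace X] [T2Space X]
    {B : Set (Set X)} (hB : TopologicalSpace.IsTopologicalBasis B) :
    ∃ a : B × B → C(X, ℝ), ∀ f : C(X, ℝ), ∀ ε > 0, ∃ T : Finset (B × B), ∀ x y,
      (∀ i ∈ T, |a i x - a i y| < 1) → |f x - f y| ≤ ε := by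
  have hex : ∀ p : B × B, ∃ h : C(X, ℝ),
      Disjoint (closure (p.1 : Set X)) (closure (p.2 : Set X)) →
        (∀ x ∈ (p.1 : Set X), h x = 0) ∧ ∀ y ∈ (p.2 : Set X), h y = 1 := by
    intro p
    by_cases hp : Disjoint (closure (p.1 : Set X)) (closure (p.2 : Set X))
    · obtain ⟨h, h0, h1, -⟩ := exists_continuous_zero_one_of_isClosed isClosed_closure
        isClosed_closure hp
      exact ⟨h, fun _ => ⟨fun x hx => h0 (subset_closure hx), fun y hy => h1 (subset_closure hy)⟩⟩
    · exact ⟨0, fun h => absurd h hp⟩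
  choose a ha using hex
  refine ⟨a, fun f ε hε => ?_⟩
  have hcpt : IsCompact {z : X × X | ε ≤ |f z.1 - f z.2|} :=
    (isClosed_le continuous_const (by fun_prop)).isCompact
  obtain ⟨T, hT⟩ := hcpt.elim_finite_subcover
    (fun p : {p : B × B // Disjoint (closure (p.1 : Set X)) (closure (p.2 : Set X))} =>
      (p.1.1 : Set X) ×ˢ (p.1.2 : Set X))
    (fun p => (hB.isOpen p.1.1.2).prod (hB.isOpen p.1.2.2))
    (by
      rintro ⟨x, y⟩ hxy
      have hne : x ≠ y := by
        rintro rfl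
        simp only [mem_ofPred_eq, sub_self, abs_zero] at hxy
        exact hxy.not_gt hε
      obtain ⟨u, hxu, hu, v, hyv, hv, huv⟩ := exists_open_nhds_disjoint_closure hne
      obtain ⟨u', hu', hxu', huu⟩ := hB.exists_subset_of_mem_open hxu hu
      obtain ⟨v', hv', hyv', hvv⟩ := hB.exists_subset_of_mem_open hyv hv
      exact mem_iUnion.2 ⟨⟨(⟨u', hu'⟩, ⟨v', hv'⟩),
        huv.mono (closure_mono huu) (closure_mono hvv)⟩, hxu', hyv'⟩)
  refine ⟨T.map (Function.Embedding.subtype _), fun x y hxy => ?_⟩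
  by_contra! hlt
  obtain ⟨p, hp, hx, hy⟩ := mem_iUnion₂.1 (hT (show (x, y) ∈ _ from hlt.le))
  have := hxy p.1 (Finset.mem_map_of_mem _ hp)
  rw [(ha p.1 p.2).1 x hx, (ha p.1 p.2).2 y hy] at this
  norm_num at this

theorem exists_isTopologicalBasis_weightCard (X : Type u) [TopologicalSpace X] :
    ∃ B : Set (Set X), TopologicalSpace.IsTopologicalBasis B ∧ #B = weightCard X :=
  csInf_mem (s := {c | ∃ B : Set (Set X), TopologicalSpace.IsTopologicalBasis B ∧ #B = c})
    ⟨_, _, TopologicalSpace.isTopologicalBasis_opens, rfl⟩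

theorem exists_cofinal_cofCtblSubsets (κ : Cardinal.{u}) :
    ∃ 𝒞 : Set (Set κ.out), (∀ C ∈ 𝒞, C.Countable ∧ C.Infinite) ∧
      (∀ S : Set κ.out, S.Countable → S.Infinite → ∃ C ∈ 𝒞, S ⊆ C) ∧ #𝒞 = cofCtblSubsets κ :=
  csInf_mem (s := {c | ∃ 𝒞 : Set (Set κ.out), (∀ C ∈ 𝒞, C.Countable ∧ C.Infinite) ∧
    (∀ S : Set κ.out, S.Countable → S.Infinite → ∃ C ∈ 𝒞, S ⊆ C) ∧ #𝒞 = c})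
    ⟨_, {C | C.Countable ∧ C.Infinite}, fun _ h => h, fun S h h' => ⟨S, ⟨h, h'⟩, Subset.rfl⟩, rfl⟩

theorem stmt12 (K : Type u) [TopologicalSpace K] [CompactSpace K] [T2Space K]
    (hw : ℵ₀ < weightCard K) (n : ℕ) (hdim : DimLE K n) :
    basicCard K ≤ cofCtblSubsets (weightCard K) := by
  obtain ⟨B, hB, hBw⟩ := exists_isTopologicalBasis_weightCard K
  obtain ⟨𝒞, hctbl, hcof, hcard⟩ := exists_cofinal_cofCtblSubsets (weightCard K)
  obtain ⟨a, ha⟩ := exists_controlling_family hB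
  have hB2 : #(B × B) = weightCard K := by
    rw [mk_prod, lift_id, hBw, mul_eq_self hw.le]
  obtain ⟨e⟩ : Nonempty ((weightCard K).out ≃ B × B) := by
    rw [← Cardinal.eq, mk_out, hB2]
  have hinf : Infinite (weightCard K).out := by
    rw [infinite_iff, mk_out]
    exact hw.le
  obtain ⟨S₀, hS₀inf, hS₀⟩ : ∃ S : Set (weightCard K).out, S.Infinite ∧ S.Countable :=
    ⟨_, Set.infinite_range_of_injective (Infinite.natEmbedding _).injective,
      Set.countable_range _⟩
  have hcover : ∀ S : Set (weightCard K).out, S.Countable → ∃ C ∈ 𝒞, S ⊆ C := by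
    intro S hS
    obtain ⟨C, hC, hSC⟩ := hcof (S ∪ S₀) (hS.union hS₀) (hS₀inf.mono subset_union_right)
    exact ⟨C, hC, subset_union_left.trans hSC⟩
  have h𝒞 : ℵ₀ ≤ #𝒞 := by
    rw [← infinite_iff, Set.infinite_coe_iff]
    intro hfin
    have hun : (⋃₀ 𝒞).Countable := hfin.countable.sUnion fun C hC => (hctbl C hC).1
    have huniv : ⋃₀ 𝒞 = Set.univ := by
      refine eq_univ_of_forall fun i => ?_
      obtain ⟨C, hC, hi⟩ := hcover {i} (countable_singleton i)
      exact ⟨C, hC, hi rfl⟩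
    rw [huniv, countable_univ_iff, ← mk_le_aleph0_iff, mk_out] at hun
    exact hun.not_gt hw
  have henum : ∀ C : 𝒞, ∃ b : ℕ → (weightCard K).out, (C : Set _) = range b := fun C =>
    (hctbl C C.2).1.exists_eq_range (hctbl C C.2).2.nonempty
  choose b hb using henum
  choose φ hφ using fun C : 𝒞 => hdim.exists_superposition fun m => a (e (b C m))
  have hbasic : IsBasicFamily (range fun q : 𝒞 × ULift.{u} (Fin (4 * (n + 1))) =>
      φ q.1 q.2.down) := by
    intro f
    choose T hT using fun m : ℕ => ha f (1 / (m + 1)) (by positivity)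
    obtain ⟨C, hC, hTC⟩ := hcover (e ⁻¹' ⋃ m, (T m : Set (B × B)))
      ((countable_iUnion fun m => (T m).countable_toSet).preimage e.injective)
    obtain ⟨g, hg⟩ := hφ ⟨C, hC⟩ f fun ε hε => by
      obtain ⟨m, hm⟩ := exists_nat_one_div_lt hε
      have hmem : ∀ i ∈ T m, ∃ l, e (b ⟨C, hC⟩ l) = i := by
        intro i hi
        have : e.symm i ∈ C := hTC (mem_iUnion.2 ⟨m, by simpa using hi⟩)
        rw [show C = range (b ⟨C, hC⟩) from hb ⟨C, hC⟩] at this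
        obtain ⟨l, hl⟩ := this
        exact ⟨l, by rw [hl, e.apply_symm_apply]⟩
      choose! l hl using hmem
      classical
      refine ⟨(T m).image l, fun x y h => (hT m x y fun i hi => ?_).trans hm.le⟩
      have := h (l i) (Finset.mem_image_of_mem l hi)
      rwa [hl i hi] at this
    exact ⟨_, φ ⟨C, hC⟩, g, fun j => ⟨(⟨C, hC⟩, ⟨j⟩), rfl⟩, hg⟩
  calc basicCard K ≤ _ := csInf_le' ⟨_, hbasic, rfl⟩
    _ ≤ #(𝒞 × ULift.{u} (Fin (4 * (n + 1)))) := mk_range_le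
    _ ≤ #𝒞 * ℵ₀ := by
      rw [mk_prod, lift_id, lift_id]
      exact mul_le_mul_right (mk_le_aleph0) _
    _ = cofCtblSubsets (weightCard K) := by
      rw [mul_aleph0_eq h𝒞, hcard]

end
end

section
/- Let K be a compact Hausdorff space of infinite weight which contains a discrete subspace D with |D| = w(K). Then basic(K) ≥ cof([w(K)]^ℵ0, ⊆). -/
open Cardinal Set Topology

noncomputable section

/-- The points which the image of `e` isolates and which are alone in their fibre. -/
def isolatedFibres {D Y : Type*} [TopologicalSpace Y] (e : D → Y) : Set D :=
  {d | ∃ U : Set Y, IsOpen U ∧ e ⁻¹' U = {d}}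

theorem countable_isolatedFibres {D Y : Type*} [TopologicalSpace Y] [SecondCountableTopology Y]
    (e : D → Y) : (isolatedFibres e).Countable := by
  have hsub : isolatedFibres e ⊆
      ⋃ b ∈ TopologicalSpace.countableBasis Y, {d | e ⁻¹' b = {d}} := by
    rintro d ⟨U, hU, hd⟩
    have hdU : e d ∈ U := by
      have : d ∈ e ⁻¹' U := by rw [hd]; rfl
      exact this
    obtain ⟨b, hb, hdb, hbU⟩ :=
      (TopologicalSpace.isBasis_countableBasis Y).exists_subset_of_mem_open hdU hU
    refine mem_biUnion hb (Subset.antisymm ?_ (singleton_subset_iff.2 hdb))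
    rw [← hd]
    exact preimage_mono hbU
  refine Countable.mono hsub ((TopologicalSpace.countable_countableBasis Y).biUnion ?_)
  intro b _
  refine Set.Subsingleton.countable ?_
  intro x hx y hy
  exact singleton_injective (Eq.trans (Eq.symm hx) hy)

/-- A sequence of distinct points of a discrete subspace is isolated, together with its values, by
a single continuous function. -/
theorem exists_continuousMap_isolating {K : Type*} [TopologicalSpace K] [CompletelyRegularSpace K]
    (D : Set K) [DiscreteTopology D] (s : ℕ → D) (hs : Function.Injective s) :
    ∃ f : C(K, ℝ), range s ⊆ isolatedFibres (fun d : D => f d) := by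
  have bump : ∀ d : D, ∃ f : C(K, ℝ), (∀ x, f x ∈ Icc (0 : ℝ) 1) ∧ f d = 1 ∧
      ∀ d' : D, d' ≠ d → f d' = 0 := by
    intro d
    obtain ⟨U, hU, hUd⟩ := isOpen_induced_iff.1 (isOpen_discrete ({d} : Set D))
    have hd : (d : K) ∉ Uᶜ := by
      have : d ∈ Subtype.val ⁻¹' U := by rw [hUd]; rfl
      exact not_not.2 this
    obtain ⟨g, hg, hg0, hg1⟩ :=
      CompletelyRegularSpace.completely_regular (d : K) Uᶜ hU.isClosed_compl hd
    refine ⟨⟨fun x => 1 - (g x : ℝ), by fun_prop⟩, fun x => ?_, ?_, ?_⟩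
    · have := (g x).2
      simp only [ContinuousMap.coe_mk, mem_Icc] at this ⊢
      constructor <;> linarith
    · simp [hg0]
    · intro d' hd'
      have : (d' : K) ∈ Uᶜ := by
        intro h
        have h2 : d' ∈ Subtype.val ⁻¹' U := h
        rw [hUd] at h2
        exact hd' h2
      simp [hg1 this]
  choose p hp01 hp1 hp0 using bump
  have hcont : Continuous fun x => ∑' n, (1 / 2 : ℝ) ^ (n + 1) * p (s n) x := by
    refine continuous_tsum (u := fun n : ℕ => (1 / 2 : ℝ) ^ (n + 1)) (fun n => by fun_prop)
      ((summable_nat_add_iff 1).2 summable_geometric_two) fun n x => ?_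
    have h := hp01 (s n) x
    rw [norm_mul, Real.norm_of_nonneg (by positivity), Real.norm_of_nonneg h.1]
    exact mul_le_of_le_one_right (by positivity) h.2
  have hval : ∀ m, ∑' n, (1 / 2 : ℝ) ^ (n + 1) * p (s n) (s m) = (1 / 2) ^ (m + 1) := by
    intro m
    rw [tsum_eq_single m fun n hn => ?_, hp1, mul_one]
    rw [hp0 (s n) (s m) fun h => hn (hs h).symm, mul_zero]
  refine ⟨⟨_, hcont⟩, ?_⟩
  rintro _ ⟨m, rfl⟩
  refine ⟨Ioo ((1 / 2) ^ (m + 2)) ((1 / 2) ^ m), isOpen_Ioo, Subset.antisymm ?_ ?_⟩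
  · rintro d ⟨h1, h2⟩
    simp only [ContinuousMap.coe_mk] at h1 h2
    by_cases hd : d ∈ range s
    · obtain ⟨n, rfl⟩ := hd
      rw [hval] at h1 h2
      have h1' := (pow_lt_pow_iff_right_of_lt_one₀ (by norm_num) (by norm_num)).1 h1
      have h2' := (pow_lt_pow_iff_right_of_lt_one₀ (by norm_num) (by norm_num)).1 h2
      have : n = m := by omega
      rw [this]; rfl
    · have : ∑' n, (1 / 2 : ℝ) ^ (n + 1) * p (s n) d = 0 := by
        have hz : ∀ n, (1 / 2 : ℝ) ^ (n + 1) * p (s n) d = 0 := fun n => by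
          rw [hp0 (s n) d fun h => hd ⟨n, h.symm⟩, mul_zero]
        simp only [hz, tsum_zero]
      rw [this] at h1
      exact absurd h1 (not_lt.2 (by positivity))
  · rw [singleton_subset_iff]
    simp only [mem_preimage, ContinuousMap.coe_mk, hval]
    exact ⟨pow_lt_pow_right_of_lt_one₀ (by norm_num) (by norm_num) (by omega),
      pow_lt_pow_right_of_lt_one₀ (by norm_num) (by norm_num) (by omega)⟩

/-- A countable infinite subset of a discrete subspace is isolated by finitely many members of a
basic family. -/
theorem IsBasicFamily.exists_subset_isolatedFibres {K : Type u} [TopologicalSpace K]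
    [CompletelyRegularSpace K] {Φ : Set C(K, ℝ)} (hΦ : IsBasicFamily Φ) (D : Set K)
    [DiscreteTopology D] {S : Set D} (hS : S.Countable) (hSi : S.Infinite) :
    ∃ F : Finset Φ, ∀ F' : Finset Φ, F ⊆ F' →
      S ⊆ isolatedFibres fun (d : D) (φ : F') => (φ : Φ).1 (d : K) := by
  classical
  have := hS.to_subtype
  have := hSi.to_subtype
  obtain ⟨_⟩ := nonempty_denumerable S
  obtain ⟨f, hf⟩ := exists_continuousMap_isolating D (fun n => ((Denumerable.eqv S).symm n : D))
    (Subtype.val_injective.comp (Denumerable.eqv S).symm.injective)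
  obtain ⟨m, φ, g, hφ, hfg⟩ := hΦ f
  refine ⟨Finset.univ.image fun i => ⟨φ i, hφ i⟩, fun F' hF' d hd => ?_⟩
  have hmem : ∀ i, (⟨φ i, hφ i⟩ : Φ) ∈ F' := fun i =>
    hF' (Finset.mem_image_of_mem _ (Finset.mem_univ i))
  have hdr : d ∈ range fun n => ((Denumerable.eqv S).symm n : D) :=
    ⟨Denumerable.eqv S ⟨d, hd⟩, by simp⟩
  obtain ⟨U, hU, hUd⟩ := hf hdr
  refine ⟨(fun y : F' → ℝ => ∑ i, g i (y ⟨⟨φ i, hφ i⟩, hmem i⟩)) ⁻¹' U,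
    hU.preimage (by fun_prop), ?_⟩
  rw [← hUd]
  ext d'
  simp [hfg]

theorem cofCtblSubsets_le_of_cover {κ : Cardinal.{u}} {D ι : Type u} (hD : #D = κ)
    (C : ι → Set D) (hC : ∀ i, (C i).Countable)
    (hcov : ∀ S : Set D, S.Countable → S.Infinite → ∃ i, S ⊆ C i) :
    cofCtblSubsets κ ≤ #ι := by
  obtain ⟨e⟩ : Nonempty (D ≃ κ.out) := Cardinal.eq.1 (hD.trans κ.mk_out.symm)
  let 𝒞 : Set (Set κ.out) := range (fun i => e '' C i) ∩ {A | A.Infinite}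
  refine le_trans (b := #𝒞) (csInf_le' ⟨𝒞, ?_, ?_, rfl⟩)
    ((mk_le_mk_of_subset inter_subset_left).trans mk_range_le)
  · rintro _ ⟨⟨i, rfl⟩, hi⟩
    exact ⟨(hC i).image e, hi⟩
  · intro S hS hSi
    obtain ⟨i, hi⟩ := hcov (e ⁻¹' S) (hS.preimage e.injective)
      (hSi.preimage (by simp [e.surjective.range_eq]))
    have hsub : S ⊆ e '' C i := fun x hx => ⟨e.symm x, hi (by simpa using hx), by simp⟩
    exact ⟨_, ⟨⟨i, rfl⟩, hSi.mono hsub⟩, hsub⟩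

theorem IsBasicFamily.univ {X : Type u} [TopologicalSpace X] :
    IsBasicFamily (Set.univ : Set C(X, ℝ)) :=
  fun f => ⟨1, fun _ => f, fun _ => ContinuousMap.id ℝ, by simp, by simp⟩

theorem IsBasicFamily.nonempty {X : Type u} [TopologicalSpace X] [Nonempty X] {Φ : Set C(X, ℝ)}
    (hΦ : IsBasicFamily Φ) : Φ.Nonempty := by
  obtain ⟨m, φ, g, hφ, h⟩ := hΦ 1
  cases m with
  | zero => simp at h
  | succ m => exact ⟨φ 0, hφ 0⟩

theorem stmt13 (K : Type u) [TopologicalSpace K] [CompactSpace K] [T2Space K]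
    (hw : ℵ₀ ≤ weightCard K) (D : Set K) (hD : DiscreteTopology D)
    (hcard : #D = weightCard K) :
    cofCtblSubsets (weightCard K) ≤ basicCard K := by
  have hDi : Infinite D := infinite_iff.2 (hcard ▸ hw)
  have : Nonempty K := ⟨(Classical.arbitrary D : D)⟩
  refine le_csInf ⟨_, Set.univ, IsBasicFamily.univ, rfl⟩ ?_
  rintro _ ⟨Φ, hΦ, rfl⟩
  let C (F : Finset Φ) : Set D := isolatedFibres fun (d : D) (φ : F) => (φ : Φ).1 (d : K)
  have hC (F : Finset Φ) : (C F).Countable := countable_isolatedFibres _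
  rcases finite_or_infinite Φ with hfin | hinf
  · have := Fintype.ofFinite Φ
    have h := cofCtblSubsets_le_of_cover (ι := PUnit) hcard (fun _ => C Finset.univ)
      (fun _ => hC _) fun S hS hSi => by
        obtain ⟨F, hF⟩ := hΦ.exists_subset_isolatedFibres D hS hSi
        exact ⟨PUnit.unit, hF _ (Finset.subset_univ F)⟩
    refine h.trans ?_
    rw [mk_punit, Cardinal.one_le_iff_ne_zero, mk_ne_zero_iff]
    exact hΦ.nonempty.to_subtype
  · rw [← mk_finset_of_infinite Φ]
    refine cofCtblSubsets_le_of_cover hcard C hC fun S hS hSi => ?_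
    obtain ⟨F, hF⟩ := hΦ.exists_subset_isolatedFibres D hS hSi
    exact ⟨F, hF F subset_rfl⟩

end
end

section
/- Let X be a nonempty Tychonoff (completely regular Hausdorff) space. If Φ ⊆ C(X) is a basic family for X, then the evaluation map x ↦ (φ(x))_{φ∈Φ} is a topological embedding of X into ℝ^Φ. Consequently w(X) ≤ max(basic(X), ℵ0) ≤ |C(X)|. -/
open Cardinal Set Topology

noncomputable section

/-- The evaluation map of a basic family on a completely regular space is inducing. -/
theorem IsBasicFamily.isInducing_eval {X : Type u} [TopologicalSpace X]
    [CompletelyRegularSpace X] {Φ : Set C(X, ℝ)} (hΦ : IsBasicFamily Φ) :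
    IsInducing (fun x : X => fun φ : Φ => (φ : C(X, ℝ)) x) := by
  have hcont : Continuous (fun x : X => fun φ : Φ => (φ : C(X, ℝ)) x) :=
    continuous_pi fun φ => φ.1.continuous
  refine isInducing_iff_nhds.2 fun x => le_antisymm hcont.continuousAt.le_comap fun V hV => ?_
  obtain ⟨U, hUV, hU, hx⟩ := mem_nhds_iff.1 hV
  obtain ⟨f, hf, hfx, hfU⟩ :=
    CompletelyRegularSpace.completely_regular_isOpen x U hU hx
  obtain ⟨m, φ, g, hφ, hsum⟩ := hΦ ⟨fun y => (f y : ℝ), continuous_subtype_val.comp hf⟩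
  have hG : Continuous fun y : Φ → ℝ => ∑ i, g i (y ⟨φ i, hφ i⟩) := by fun_prop
  refine Filter.mem_comap.2 ⟨_, (isOpen_Iio.preimage hG).mem_nhds (?_ : _ < (1 : ℝ)), ?_⟩
  · simp [← hsum, hfx]
  · refine Subset.trans (fun y hy => ?_) hUV
    by_contra hyU
    have hlt : ∑ i, g i (φ i y) < 1 := hy
    simp [← hsum, hfU hyU] at hlt

/-- The evaluation map of a basic family on a Tychonoff space is an embedding. -/
theorem IsBasicFamily.isEmbedding_eval {X : Type u} [TopologicalSpace X]
    [CompletelyRegularSpace X] [T0Space X] {Φ : Set C(X, ℝ)} (hΦ : IsBasicFamily Φ) :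
    IsEmbedding (fun x : X => fun φ : Φ => (φ : C(X, ℝ)) x) :=
  hΦ.isInducing_eval.isEmbedding

theorem isBasicFamily_univ (X : Type u) [TopologicalSpace X] :
    IsBasicFamily (univ : Set C(X, ℝ)) := fun f =>
  ⟨1, fun _ => f, fun _ => ContinuousMap.id ℝ, fun _ => mem_univ _, fun x => by simp⟩

theorem exists_isBasicFamily_mk_eq_basicCard (X : Type u) [TopologicalSpace X] :
    ∃ Φ : Set C(X, ℝ), IsBasicFamily Φ ∧ #Φ = basicCard X :=
  csInf_mem (s := { c | ∃ Φ : Set C(X, ℝ), IsBasicFamily Φ ∧ #Φ = c })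
    ⟨_, univ, isBasicFamily_univ X, rfl⟩

theorem basicCard_le_mk (X : Type u) [TopologicalSpace X] : basicCard X ≤ #C(X, ℝ) :=
  csInf_le' ⟨univ, isBasicFamily_univ X, mk_univ⟩

theorem weightCard_le_mk_of_generateFrom {X : Type u} [t : TopologicalSpace X] {ι : Type u}
    (s : ι → Set X) (hs : t = TopologicalSpace.generateFrom (range s)) :
    weightCard X ≤ max #ι ℵ₀ := by
  classical
  have hB := TopologicalSpace.isTopologicalBasis_of_subbasis hs
  have hw : weightCard X ≤ #((fun f => ⋂₀ f) '' {f : Set (Set X) | f.Finite ∧ f ⊆ range s}) :=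
    csInf_le' ⟨_, hB, rfl⟩
  refine hw.trans ?_
  have hsub : (fun f => ⋂₀ f) '' {f : Set (Set X) | f.Finite ∧ f ⊆ range s} ⊆
      range (fun F : Finset ι => ⋂ i ∈ F, s i) := by
    rintro _ ⟨f, ⟨hf, hfs⟩, rfl⟩
    obtain ⟨G, -, hG⟩ := Finset.subset_set_image_iff.1
      (show (hf.toFinset : Set (Set X)) ⊆ s '' univ by simpa using hfs)
    refine ⟨G, ?_⟩
    rw [← hf.coe_toFinset, ← hG]
    simp
  refine (mk_le_mk_of_subset hsub).trans (mk_range_le.trans ?_)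
  cases finite_or_infinite ι
  · exact le_max_of_le_right (lt_aleph0_of_finite _).le
  · simp

/-- A topology induced by a family of real-valued functions has weight at most the
cardinality of the family, or `ℵ₀`. -/
theorem weightCard_le_of_isInducing_pi {X : Type u} [TopologicalSpace X] {ι : Type u}
    {e : X → ι → ℝ} (he : IsInducing e) : weightCard X ≤ max #ι ℵ₀ := by
  let B := TopologicalSpace.countableBasis ℝ
  have hgen := weightCard_le_mk_of_generateFrom
    (fun p : ι × ULift.{u} B => (fun x => e x p.1) ⁻¹' (p.2.down : Set ℝ)) (by
      rw [he.eq_induced, induced_to_pi]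
      simp only [(TopologicalSpace.isBasis_countableBasis ℝ).eq_generateFrom,
        induced_generateFrom_eq]
      rw [← generateFrom_iUnion]
      congr 1
      ext s
      simp [B])
  refine hgen.trans (max_le ?_ (le_max_right _ _))
  have hBc : #(ULift.{u} B) ≤ ℵ₀ := by
    have : Countable B := (TopologicalSpace.countable_countableBasis ℝ).to_subtype
    exact mk_le_aleph0
  rw [mk_prod, lift_id, lift_id]
  exact (mul_le_mul' le_rfl hBc).trans
    ((mul_le_max _ _).trans (max_le le_rfl (le_max_right _ _)))

theorem weightCard_le_max_basicCard (X : Type u) [TopologicalSpace X]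
    [CompletelyRegularSpace X] : weightCard X ≤ max (basicCard X) ℵ₀ := by
  obtain ⟨Φ, hΦ, hcard⟩ := exists_isBasicFamily_mk_eq_basicCard X
  exact hcard ▸ weightCard_le_of_isInducing_pi hΦ.isInducing_eval

theorem aleph0_le_mk_continuousMap_real (X : Type u) [TopologicalSpace X] [Nonempty X] :
    ℵ₀ ≤ #C(X, ℝ) :=
  have : Infinite C(X, ℝ) := Infinite.of_injective (ContinuousMap.const X) fun a b h => by
    simpa using DFunLike.congr_fun h (Classical.arbitrary X)
  aleph0_le_mk _

theorem stmt16 (X : Type u) [TopologicalSpace X] [CompletelyRegularSpace X]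
    [T2Space X] [Nonempty X] :
    (∀ Φ : Set C(X, ℝ), IsBasicFamily Φ →
      IsEmbedding (fun x : X => fun φ : Φ => (φ : C(X, ℝ)) x)) ∧
    weightCard X ≤ max (basicCard X) ℵ₀ ∧ max (basicCard X) ℵ₀ ≤ #C(X, ℝ) := by
  exact ⟨fun _ hΦ => hΦ.isEmbedding_eval, weightCard_le_max_basicCard X,
    max_le (basicCard_le_mk X) (aleph0_le_mk_continuousMap_real X)⟩

end
end

section
/- (Kolmogorov Superposition Theorem) For a fixed n ≥ 2, there are n(2n+1) continuous maps ψ_{pq} : [0,1] → ℝ (1 ≤ p ≤ n, 1 ≤ q ≤ 2n+1) such that every continuous f : [0,1]ⁿ → ℝ can be written f(x) = Σ_{q=1}^{2n+1} g_q(φ_q(x)), where φ_q(x_1,…,x_n) = Σ_{p=1}^n ψ_{pq}(x_p) and the g_q : ℝ → ℝ are continuous maps depending on f. -/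
open Cardinal Set Topology

noncomputable section

lemma surjective_of_approx {E F : Type*} [NormedAddCommGroup E] [CompleteSpace E]
    [NormedAddCommGroup F] (T : E →+ F) (hT : Continuous T) (C θ : ℝ) (hθ : 0 ≤ θ)
    (hθ1 : θ < 1) (h : ∀ f : F, ∃ g : E, ‖g‖ ≤ C * ‖f‖ ∧ ‖f - T g‖ ≤ θ * ‖f‖) :
    Function.Surjective T := by
  choose S hS hTS using h
  intro f
  let u : ℕ → F := fun k => (fun f => f - T (S f))^[k] f
  have hu (k : ℕ) : u (k + 1) = u k - T (S (u k)) := Function.iterate_succ_apply' _ _ _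
  have hnorm (k : ℕ) : ‖u k‖ ≤ θ ^ k * ‖f‖ := by
    induction k with
    | zero => simp [u]
    | succ k ih =>
      rw [hu, pow_succ']
      calc _ ≤ θ * ‖u k‖ := hTS _
        _ ≤ θ * (θ ^ k * ‖f‖) := by gcongr
        _ = _ := by ring
  have hC (k : ℕ) : ‖S (u k)‖ ≤ |C| * ‖f‖ * θ ^ k := by
    calc _ ≤ C * ‖u k‖ := hS _
      _ ≤ |C| * (θ ^ k * ‖f‖) := by gcongr; exacts [le_abs_self C, hnorm k]
      _ = _ := by ring
  have hsum : Summable fun k => S (u k) :=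
    .of_norm_bounded ((summable_geometric_of_lt_one hθ hθ1).mul_left _) hC
  refine ⟨∑' k, S (u k), tendsto_nhds_unique
    ((hT.tendsto _).comp hsum.hasSum.tendsto_sum_nat) ?_⟩
  have hpart (m : ℕ) : T (∑ k ∈ Finset.range m, S (u k)) = f - u m := by
    induction m with
    | zero => simp [u]
    | succ m ih => rw [Finset.sum_range_succ, map_add, ih, hu]; abel
  have hlim : Filter.Tendsto u Filter.atTop (𝓝 0) := by
    refine squeeze_zero_norm hnorm ?_
    simpa using (tendsto_pow_atTop_nhds_zero_of_lt_one hθ hθ1).mul_const ‖f‖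
  simpa [Function.comp_def, hpart] using hlim.const_sub f

lemma exists_close_injective_sum (n M : ℕ) (d : Fin n → Fin M → ℝ) (ε : ℝ) (hε : 0 < ε) :
    ∃ c : Fin n → Fin M → ℝ, (∀ p k, |c p k - d p k| ≤ ε) ∧
      Function.Injective fun k : Fin n → Fin M => ∑ p, c p (k p) := by
  rcases Nat.eq_zero_or_pos M with rfl | hM
  · exact ⟨d, fun _ k => k.elim0, fun a b _ => funext fun p => (a p).elim0⟩
  have hM' : (0 : ℝ) < (M : ℝ) ^ n := by positivity
  refine ⟨fun p k => ε * (⌊d p k / ε⌋ + (k * M ^ (p : ℕ) : ℕ) / (M : ℝ) ^ n), ?_, ?_⟩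
  · intro p k
    have hw0 : (0 : ℝ) ≤ ((k * M ^ (p : ℕ) : ℕ) : ℝ) / (M : ℝ) ^ n := by positivity
    have hw1 : ((k * M ^ (p : ℕ) : ℕ) : ℝ) / (M : ℝ) ^ n ≤ 1 := by
      rw [div_le_one hM']
      have : k * M ^ (p : ℕ) ≤ M ^ n := calc
        _ ≤ M * M ^ (p : ℕ) := Nat.mul_le_mul_right _ k.2.le
        _ = M ^ ((p : ℕ) + 1) := by ring
        _ ≤ M ^ n := Nat.pow_le_pow_right hM p.2
      exact_mod_cast this
    beta_reduce
    generalize ((k * M ^ (p : ℕ) : ℕ) : ℝ) / (M : ℝ) ^ n = w at hw0 hw1 ⊢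
    have h1 := Int.floor_le (d p k / ε)
    have h2 := Int.lt_floor_add_one (d p k / ε)
    have h3 : d p k = ε * (d p k / ε) := by field_simp
    generalize d p k / ε = z at h1 h2 h3 ⊢
    rw [h3, ← mul_sub, abs_mul, abs_of_pos hε]
    exact mul_le_of_le_one_right hε.le (abs_le.2 ⟨by linarith, by linarith⟩)
  · have key (k : Fin n → Fin M) :
        ∑ p, ε * (⌊d p (k p) / ε⌋ + (k p * M ^ (p : ℕ) : ℕ) / (M : ℝ) ^ n) =
          ε / (M : ℝ) ^ n *
            ((M ^ n : ℤ) * ∑ p, ⌊d p (k p) / ε⌋ + ((finFunctionFinEquiv k : ℕ) : ℤ) : ℤ) := by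
      rw [← Finset.mul_sum, Finset.sum_add_distrib, ← Finset.sum_div, finFunctionFinEquiv_apply]
      push_cast
      field_simp
    intro a b hab
    simp only [key] at hab
    have hab' := Int.cast_injective (mul_left_cancel₀ (by positivity) hab)
    apply finFunctionFinEquiv.injective
    apply Fin.ext
    have := congrArg (· % (M ^ n : ℤ)) hab'
    simp only [Int.mul_add_emod_self_left] at this
    rw [Int.emod_eq_of_lt (by positivity) (by exact_mod_cast Fin.is_lt _),
      Int.emod_eq_of_lt (by positivity) (by exact_mod_cast Fin.is_lt _)] at this
    exact_mod_cast this

lemma exists_grid (Q N : ℕ) (hN : 0 < N) :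
    ∃ (A : Fin Q → Set (Icc (0 : ℝ) 1)) (κ : Fin Q → Icc (0 : ℝ) 1 → Fin (N + 1))
      (r : Fin Q → Fin (N + 1) → Icc (0 : ℝ) 1),
      (∀ q, IsClosed (A q)) ∧ (∀ q, ContinuousOn (κ q) (A q)) ∧
      (∀ q x, dist x (r q (κ q x)) ≤ 1 / N) ∧
      ∀ x q q', x ∉ A q → x ∉ A q' → q = q' := by
  rcases Nat.eq_zero_or_pos Q with rfl | hQ
  · exact ⟨fun q => q.elim0, fun q => q.elim0, fun q => q.elim0, fun q => q.elim0,
      fun q => q.elim0, fun q => q.elim0, fun _ q => q.elim0⟩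
  have hQ' : (0 : ℝ) < Q := by exact_mod_cast hQ
  have hN' : (0 : ℝ) < N := by exact_mod_cast hN
  let y : Fin Q → Icc (0 : ℝ) 1 → ℝ := fun q x => N * x + q / Q
  have hy (q) : Continuous (y q) := by fun_prop
  have hy0 (q x) : 0 ≤ y q x := by
    have := x.2.1
    positivity
  have hy1 (q x) : y q x < N + 1 := by
    have h1 : (q : ℝ) / Q < 1 := by rw [div_lt_one hQ']; exact_mod_cast q.2
    have h2 : (N : ℝ) * x ≤ N := mul_le_of_le_one_right hN'.le x.2.2
    simp only [y]; linarith
  refine ⟨fun q => {x | ∀ k : ℤ, 1 / (2 * Q) ≤ |y q x - k|},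
    fun q x => ⟨⌊y q x⌋₊, (Nat.floor_lt (hy0 q x)).2 (by exact_mod_cast hy1 q x)⟩,
    fun q k => projIcc 0 1 zero_le_one (((k : ℕ) - q / Q) / N), ?_, ?_, ?_, ?_⟩
  · intro q
    simp only [ofPred_forall]
    exact isClosed_iInter fun k => isClosed_le continuous_const (by fun_prop)
  · intro q x hx
    refine ContinuousAt.continuousWithinAt ?_
    have hlt : (⌊y q x⌋₊ : ℝ) < y q x := by
      refine lt_of_le_of_ne (Nat.floor_le (hy0 q x)) fun h => ?_
      have := hx ⌊y q x⌋₊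
      rw [Int.cast_natCast, h, sub_self, abs_zero] at this
      have : (0 : ℝ) < 1 / (2 * Q) := by positivity
      linarith
    have hev : ∀ᶠ z in 𝓝 x, y q z ∈ Ioo (⌊y q x⌋₊ : ℝ) (⌊y q x⌋₊ + 1) :=
      (hy q).continuousAt.eventually (Ioo_mem_nhds hlt (Nat.lt_floor_add_one _))
    refine ContinuousAt.congr (f := fun _ =>
      (⟨⌊y q x⌋₊, (Nat.floor_lt (hy0 q x)).2 (by exact_mod_cast hy1 q x)⟩ : Fin (N + 1)))
      continuousAt_const ?_
    filter_upwards [hev] with z hz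
    exact Fin.ext ((Nat.floor_eq_iff (hy0 q z)).2 ⟨hz.1.le, hz.2⟩).symm
  · intro q x
    have hx : projIcc (0 : ℝ) 1 zero_le_one x = x := projIcc_val _ x
    have h1 := Nat.floor_le (hy0 q x)
    have h2 := Nat.lt_floor_add_one (y q x)
    have hd := (LipschitzWith.projIcc (zero_le_one (α := ℝ))).dist_le_mul x
      (((⌊y q x⌋₊ : ℝ) - q / Q) / N)
    rw [hx] at hd
    refine hd.trans ?_
    rw [NNReal.coe_one, one_mul, Real.dist_eq, abs_le]
    have : (x : ℝ) - ((⌊y q x⌋₊ : ℝ) - q / Q) / N = (y q x - ⌊y q x⌋₊) / N := by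
      simp only [y]; field_simp; ring
    rw [this]
    constructor
    · have : 0 ≤ (y q x - ⌊y q x⌋₊) / N := div_nonneg (by linarith) hN'.le
      have : 0 ≤ 1 / (N : ℝ) := by positivity
      linarith
    · gcongr; linarith
  · intro x q q' h h'
    simp only [mem_ofPred_eq, not_forall, not_le] at h h'
    obtain ⟨k, hk⟩ := h
    obtain ⟨k', hk'⟩ := h'
    have hlt : |((q : ℝ) - q') / Q - (k - k')| < 1 / Q := by
      have : ((q : ℝ) - q') / Q - (k - k') = (y q x - k) - (y q' x - k') := by
        simp only [y]; ring
      rw [this]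
      calc _ ≤ |y q x - k| + |y q' x - k'| := abs_sub _ _
        _ < 1 / (2 * Q) + 1 / (2 * Q) := add_lt_add hk hk'
        _ = _ := by field_simp; norm_num
    have hlt' : |((q : ℤ) - q') - Q * (k - k')| < 1 := by
      have : (|((q : ℤ) - q') - Q * (k - k')| : ℝ) < 1 := by
        have e : ((q : ℝ) - q') - Q * (k - k') = Q * (((q : ℝ) - q') / Q - (k - k')) := by
          field_simp
        push_cast
        rw [e, abs_mul, abs_of_pos hQ']
        calc _ < (Q : ℝ) * (1 / Q) := by gcongr
          _ = 1 := by field_simp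
      exact_mod_cast this
    rw [Int.abs_lt_one_iff, sub_eq_zero] at hlt'
    have hz : (q : ℤ) - q' = 0 := by
      refine Int.eq_zero_of_abs_lt_dvd ⟨_, hlt'⟩ ?_
      have := q.2
      have := q'.2
      rw [abs_lt]; omega
    exact Fin.ext (by omega)


/-- The map `x ↦ ∑ p, ψ p q (x p)`. -/
def superpose {n Q : ℕ} (ψ : Fin n → Fin Q → C(Icc (0 : ℝ) 1, ℝ)) (q : Fin Q) :
    C(Fin n → Icc (0 : ℝ) 1, ℝ) :=
  ∑ p, (ψ p q).comp ⟨fun x => x p, continuous_apply p⟩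

lemma superpose_apply {n Q : ℕ} (ψ : Fin n → Fin Q → C(Icc (0 : ℝ) 1, ℝ)) (q : Fin Q)
    (x : Fin n → Icc (0 : ℝ) 1) : superpose ψ q x = ∑ p, ψ p q (x p) := by
  simp [superpose]

lemma continuous_superpose {n Q : ℕ} (q : Fin Q) :
    Continuous fun ψ : Fin n → Fin Q → C(Icc (0 : ℝ) 1, ℝ) => superpose ψ q := by
  unfold superpose
  fun_prop

lemma exists_approx_of_values {n N : ℕ}
    (ψ : Fin n → Fin (2 * n + 1) → C(Icc (0 : ℝ) 1, ℝ))
    (f : C(Fin n → Icc (0 : ℝ) 1, ℝ)) (ε : ℝ)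
    (A : Fin (2 * n + 1) → Set (Icc (0 : ℝ) 1))
    (κ : Fin (2 * n + 1) → Icc (0 : ℝ) 1 → Fin N)
    (r : Fin (2 * n + 1) → Fin N → Icc (0 : ℝ) 1)
    (c : Fin (2 * n + 1) → Fin n → Fin N → ℝ)
    (hA : ∀ x q q', x ∉ A q → x ∉ A q' → q = q')
    (hψ : ∀ p q, ∀ x ∈ A q, ψ p q x = c q p (κ q x))
    (hc : ∀ q, Function.Injective fun k : Fin n → Fin N => ∑ p, c q p (k p))
    (hf : ∀ q x, |f x - f fun p => r q (κ q (x p))| ≤ ε) :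
    ∃ g : Fin (2 * n + 1) → BoundedContinuousFunction ℝ ℝ, ‖g‖ ≤ ‖f‖ ∧
      ∀ x, |f x - ∑ q, g q (superpose ψ q x)| ≤ ε + 2 * n / (2 * n + 1) * ‖f‖ := by
  have hQ : (0 : ℝ) < 2 * n + 1 := by positivity
  have hex (q : Fin (2 * n + 1)) : ∃ g : BoundedContinuousFunction ℝ ℝ,
      ‖g‖ ≤ ‖f‖ / (2 * n + 1) ∧ ∀ k : Fin n → Fin N,
        g (∑ p, c q p (k p)) = f (fun p => r q (k p)) / (2 * n + 1) := by
    let F : BoundedContinuousFunction (Fin n → Fin N) ℝ := .mkOfCompact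
      ⟨fun k => f (fun p => r q (k p)) / (2 * n + 1), continuous_of_discreteTopology⟩
    obtain ⟨g, hg, hgF⟩ := F.exists_extension_norm_eq_of_isClosedEmbedding
      (continuous_of_discreteTopology.isClosedEmbedding (hc q))
    refine ⟨g, ?_, fun k => congrFun hgF k⟩
    rw [hg, F.norm_le (by positivity)]
    intro k
    change ‖f _ / _‖ ≤ _
    rw [norm_div, Real.norm_of_nonneg hQ.le]
    gcongr
    exact f.norm_coe_le_norm _
  choose g hg hgk using hex
  have hgf (q) (y : ℝ) : |g q y| ≤ ‖f‖ / (2 * n + 1) := ((g q).norm_coe_le_norm y).trans (hg q)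
  refine ⟨g, (pi_norm_le_iff_of_nonneg (norm_nonneg f)).2 fun q => (hg q).trans
    (div_le_self (norm_nonneg f) (by linarith [n.cast_nonneg (α := ℝ)])), fun x => ?_⟩
  classical
  let B : Finset (Fin (2 * n + 1)) := {q | ∃ p, x p ∉ A q}
  have hB : B.card ≤ n := by
    have hmem (q : B) : ∃ p, x p ∉ A q := (Finset.mem_filter.1 q.2).2
    choose P hP using hmem
    have hinj : Function.Injective P := fun q q' h =>
      Subtype.ext (hA _ q q' (hP q) (h ▸ hP q'))
    simpa using Fintype.card_le_of_injective P hinj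
  have hfx : |f x| ≤ ‖f‖ := f.norm_coe_le_norm x
  have hε : 0 ≤ ε := (abs_nonneg _).trans (hf 0 x)
  have hterm (q) : |f x / (2 * n + 1) - g q (superpose ψ q x)| ≤
      ε / (2 * n + 1) + if q ∈ B then 2 * (‖f‖ / (2 * n + 1)) else 0 := by
    split_ifs with hq
    · have h1 : |f x / (2 * n + 1)| ≤ ‖f‖ / (2 * n + 1) := by
        rw [abs_div, abs_of_pos hQ]
        gcongr
      have h2 := abs_sub (f x / (2 * n + 1)) (g q (superpose ψ q x))
      have h3 := hgf q (superpose ψ q x)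
      have h4 : 0 ≤ ε / (2 * n + 1) := by positivity
      linarith
    · have hq' (p) : x p ∈ A q := by
        by_contra h
        exact hq (by simpa [B] using ⟨p, h⟩)
      rw [superpose_apply, Finset.sum_congr rfl fun p _ => hψ p q _ (hq' p),
        hgk q fun p => κ q (x p), ← sub_div, abs_div, abs_of_pos hQ, add_zero]
      gcongr
      exact hf q x
  calc |f x - ∑ q, g q (superpose ψ q x)|
      = |∑ q, (f x / (2 * n + 1) - g q (superpose ψ q x))| := by
        rw [Finset.sum_sub_distrib]
        congr 2
        simp only [Finset.sum_const, Finset.card_univ, Fintype.card_fin, nsmul_eq_mul]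
        push_cast
        field_simp
    _ ≤ ∑ q, |f x / (2 * n + 1) - g q (superpose ψ q x)| := Finset.abs_sum_le_sum_abs _ _
    _ ≤ ∑ q, (ε / (2 * n + 1) + if q ∈ B then 2 * (‖f‖ / (2 * n + 1)) else 0) :=
        Finset.sum_le_sum fun q _ => hterm q
    _ = ε + B.card * (2 * (‖f‖ / (2 * n + 1))) := by
        rw [Finset.sum_add_distrib, Finset.sum_ite_mem, Finset.univ_inter]
        simp only [Finset.sum_const, Finset.card_univ, Fintype.card_fin, nsmul_eq_mul]
        push_cast
        field_simp
    _ ≤ ε + n * (2 * (‖f‖ / (2 * n + 1))) := by gcongr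
    _ = _ := by ring

lemma exists_near_approx {n : ℕ} (ψ₀ : Fin n → Fin (2 * n + 1) → C(Icc (0 : ℝ) 1, ℝ))
    (f : C(Fin n → Icc (0 : ℝ) 1, ℝ)) (δ ε : ℝ) (hδ : 0 < δ) (hε : 0 < ε) :
    ∃ ψ : Fin n → Fin (2 * n + 1) → C(Icc (0 : ℝ) 1, ℝ), dist ψ ψ₀ ≤ δ ∧
      ∃ g : Fin (2 * n + 1) → BoundedContinuousFunction ℝ ℝ, ‖g‖ ≤ ‖f‖ ∧
        ∀ x, |f x - ∑ q, g q (superpose ψ q x)| ≤ ε + 2 * n / (2 * n + 1) * ‖f‖ := by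
  obtain ⟨η₁, hη₁, hf⟩ := Metric.uniformContinuous_iff.1
    (CompactSpace.uniformContinuous_of_continuous f.continuous) ε hε
  have hΨ : Continuous fun x => fun p q => ψ₀ p q x := by fun_prop
  obtain ⟨η₂, hη₂, hψ₀⟩ := Metric.uniformContinuous_iff.1
    (CompactSpace.uniformContinuous_of_continuous hΨ) (δ / 2) (half_pos hδ)
  obtain ⟨m, hm⟩ := exists_nat_one_div_lt (lt_min hη₁ hη₂)
  obtain ⟨A, κ, r, hAc, hκ, hr, hA⟩ := exists_grid (2 * n + 1) (m + 1) m.succ_pos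
  replace hr (q x) : dist x (r q (κ q x)) < min η₁ η₂ :=
    (hr q x).trans_lt (by exact_mod_cast hm)
  choose c hcd hc using fun q => exists_close_injective_sum n (m + 1 + 1)
    (fun p k => ψ₀ p q (r q k)) (δ / 2) (half_pos hδ)
  have hex (p q) : ∃ ψ : C(Icc (0 : ℝ) 1, ℝ), dist ψ (ψ₀ p q) ≤ δ ∧
      ∀ x ∈ A q, ψ x = c q p (κ q x) := by
    have : CompactSpace (A q) := isCompact_iff_compactSpace.1 (hAc q).isCompact
    let h : BoundedContinuousFunction (A q) ℝ := .mkOfCompact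
      ⟨fun x => c q p (κ q x) - ψ₀ p q x,
        ((continuous_of_discreteTopology (f := c q p)).comp (hκ q).domRestrict).sub
          ((ψ₀ p q).continuous.comp continuous_subtype_val)⟩
    have hh : ‖h‖ ≤ δ := by
      rw [h.norm_le hδ.le]
      intro x
      have h1 := hcd q p (κ q x)
      have h2 := hψ₀ ((hr q x).trans_le (min_le_right _ _))
      replace h2 := ((dist_le_pi_dist (fun q => ψ₀ p q x) (fun q => ψ₀ p q (r _ _)) q).trans
        (dist_le_pi_dist (fun p q => ψ₀ p q x) (fun p q => ψ₀ p q (r _ _)) p)).trans_lt h2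
      rw [dist_comm, Real.dist_eq] at h2
      change |c q p (κ q x) - ψ₀ p q x| ≤ δ
      have h3 := abs_sub_le (c q p (κ q x)) (ψ₀ p q (r q (κ q x))) (ψ₀ p q x)
      linarith
    obtain ⟨H, hH, hHh⟩ := h.exists_norm_eq_domRestrict_eq_of_closed (hAc q)
    refine ⟨ψ₀ p q + H.toContinuousMap, ?_, fun x hx => ?_⟩
    · rw [dist_eq_norm, add_sub_cancel_left, ContinuousMap.norm_le _ hδ.le]
      exact fun x => (H.norm_coe_le_norm x).trans (hH.trans_le hh)
    · have := DFunLike.congr_fun hHh ⟨x, hx⟩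
      change H x = c q p (κ q x) - ψ₀ p q x at this
      change ψ₀ p q x + H x = _
      rw [this]; ring
  choose ψ hψ hψc using hex
  refine ⟨ψ, (dist_pi_le_iff hδ.le).2 fun p => (dist_pi_le_iff hδ.le).2 fun q => hψ p q, ?_⟩
  refine exists_approx_of_values ψ f ε A κ r c hA hψc hc fun q x => ?_
  rw [← Real.dist_eq]
  refine (hf ?_).le
  exact (dist_pi_lt_iff hη₁).2 fun p => (hr q (x p)).trans_le (min_le_left _ _)

/-- The linear map `g ↦ ∑ q, g q ∘ superpose ψ q`. -/
def superposeHom {n Q : ℕ} (ψ : Fin n → Fin Q → C(Icc (0 : ℝ) 1, ℝ)) :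
    (Fin Q → BoundedContinuousFunction ℝ ℝ) →+ C(Fin n → Icc (0 : ℝ) 1, ℝ) :=
  .mk' (fun g => ∑ q, (g q).toContinuousMap.comp (superpose ψ q)) fun g g' => by
    ext x
    simp [Finset.sum_add_distrib]

lemma superposeHom_apply {n Q : ℕ} (ψ : Fin n → Fin Q → C(Icc (0 : ℝ) 1, ℝ))
    (g : Fin Q → BoundedContinuousFunction ℝ ℝ) (x : Fin n → Icc (0 : ℝ) 1) :
    superposeHom ψ g x = ∑ q, g q (superpose ψ q x) := by
  simp [superposeHom]

lemma continuous_superposeHom {n Q : ℕ} (ψ : Fin n → Fin Q → C(Icc (0 : ℝ) 1, ℝ)) :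
    Continuous (superposeHom ψ) := by
  refine AddMonoidHomClass.continuous_of_bound _ Q fun g => ?_
  rw [ContinuousMap.norm_le _ (by positivity)]
  intro x
  rw [superposeHom_apply]
  refine (norm_sum_le_of_le _ fun q _ =>
    ((g q).norm_coe_le_norm _).trans (norm_le_pi_norm g q)).trans_eq ?_
  simp

lemma continuous_superposeHom_left {n Q : ℕ} (g : Fin Q → BoundedContinuousFunction ℝ ℝ) :
    Continuous fun ψ : Fin n → Fin Q → C(Icc (0 : ℝ) 1, ℝ) => superposeHom ψ g := by
  change Continuous fun ψ => ∑ q, (g q).toContinuousMap.comp (superpose ψ q)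
  exact continuous_finsetSum _ fun q _ =>
    (ContinuousMap.continuous_postcomp _).comp (continuous_superpose q)

lemma exists_surjective_superposeHom (n : ℕ) :
    ∃ ψ : Fin n → Fin (2 * n + 1) → C(Icc (0 : ℝ) 1, ℝ),
      Function.Surjective (superposeHom ψ) := by
  have hQ : (0 : ℝ) < 2 * n + 1 := by positivity
  let ε : ℝ := 1 / (8 * (2 * n + 1))
  have hε : 0 < ε := by positivity
  have hε1 : ε ≤ 1 := (div_le_one (by positivity)).2 (by linarith [n.cast_nonneg (α := ℝ)])
  let θ : ℝ := 2 * n / (2 * n + 1) + 2 * ε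
  have hθ : 0 ≤ θ := by positivity
  let U (f : C(Fin n → Icc (0 : ℝ) 1, ℝ)) :
      Set (Fin n → Fin (2 * n + 1) → C(Icc (0 : ℝ) 1, ℝ)) :=
    {ψ | f ≠ 0 → ∃ g, ‖g‖ ≤ ‖f‖ ∧ ‖f - superposeHom ψ g‖ < θ * ‖f‖}
  have hUo (f) : IsOpen (U f) := by
    by_cases hf : f = 0
    · simp [U, hf]
    have : U f = ⋃ g ∈ {g | ‖g‖ ≤ ‖f‖}, {ψ | ‖f - superposeHom ψ g‖ < θ * ‖f‖} := by
      ext ψ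
      simp [U, hf]
    rw [this]
    exact isOpen_biUnion fun g _ => isOpen_lt
      (continuous_const.sub (continuous_superposeHom_left g)).norm continuous_const
  have hUd (f) : Dense (U f) := by
    refine Metric.dense_iff.2 fun ψ₀ δ hδ => ?_
    by_cases hf : f = 0
    · exact ⟨ψ₀, Metric.mem_ball_self hδ, fun h => absurd hf h⟩
    have hf' : 0 < ‖f‖ := norm_pos_iff.2 hf
    obtain ⟨ψ, hψ, g, hg, hfg⟩ := exists_near_approx ψ₀ f (δ / 2) (ε * ‖f‖) (half_pos hδ)
      (by positivity)
    refine ⟨ψ, hψ.trans_lt (half_lt_self hδ), fun _ => ⟨g, hg, ?_⟩⟩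
    refine lt_of_le_of_lt ((ContinuousMap.norm_le _ (by positivity)).2 fun x => ?_)
      (show ε * ‖f‖ + 2 * n / (2 * n + 1) * ‖f‖ < θ * ‖f‖ by
        simp only [θ]; nlinarith [mul_pos hε hf'])
    simpa [superposeHom_apply] using hfg x
  obtain ⟨S, hSc, hSd⟩ := TopologicalSpace.exists_countable_dense C(Fin n → Icc (0 : ℝ) 1, ℝ)
  have : TopologicalSpace.IsCompletelyPseudoMetrizableSpace
      (Fin n → Fin (2 * n + 1) → C(Icc (0 : ℝ) 1, ℝ)) := inferInstance
  obtain ⟨ψ, hψ⟩ := (dense_biInter_of_isOpen (fun f _ => hUo f) hSc fun f _ => hUd f).nonempty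
  refine ⟨ψ, surjective_of_approx _ (continuous_superposeHom ψ) 2 (θ + 2 * ε) (by positivity)
    ?_ fun f => ?_⟩
  · have : θ + 2 * ε = (2 * n + 1 / 2) / (2 * n + 1) := by
      simp only [θ, ε]; field_simp; ring
    rw [this, div_lt_one hQ]
    linarith
  by_cases hf : f = 0
  · exact ⟨0, by simp [hf]⟩
  have hf' : 0 < ‖f‖ := norm_pos_iff.2 hf
  obtain ⟨f₁, hf₁S, hf₁⟩ := hSd.exists_dist_lt f (show 0 < ε * ‖f‖ / 2 by positivity)
  rw [dist_eq_norm] at hf₁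
  have hε2 : ε * ‖f‖ ≤ ‖f‖ := mul_le_of_le_one_left hf'.le hε1
  have hf₁0 : f₁ ≠ 0 := by
    rintro rfl
    rw [sub_zero] at hf₁
    linarith
  obtain ⟨g, hg, hfg⟩ := mem_iInter₂.1 hψ f₁ hf₁S hf₁0
  have hf₁n : ‖f₁‖ ≤ ‖f‖ + ε * ‖f‖ / 2 := by
    linarith [norm_sub_norm_le f₁ f, norm_sub_rev f₁ f]
  have hθ1 : θ ≤ 1 := by
    have : θ = (2 * n + 1 / 4) / (2 * n + 1) := by
      simp only [θ, ε]; field_simp; ring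
    rw [this, div_le_one hQ]
    linarith
  refine ⟨g, by linarith, ?_⟩
  have htri := norm_sub_le_norm_sub_add_norm_sub f f₁ (superposeHom ψ g)
  have hθf : θ * ‖f₁‖ ≤ θ * ‖f‖ + ε * ‖f‖ / 2 := by
    nlinarith [mul_le_mul_of_nonneg_left hf₁n hθ, mul_pos hε hf']
  nlinarith [mul_pos hε hf']

theorem stmt17 (n : ℕ) (hn : 2 ≤ n) :
    ∃ ψ : Fin n → Fin (2 * n + 1) → C(↥(Set.Icc (0:ℝ) 1), ℝ),
      ∀ f : C((Fin n → ↥(Set.Icc (0:ℝ) 1)), ℝ),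
        ∃ g : Fin (2 * n + 1) → C(ℝ, ℝ),
          ∀ x : Fin n → ↥(Set.Icc (0:ℝ) 1), f x = ∑ q, g q (∑ p, ψ p q (x p)) := by
  obtain ⟨ψ, hψ⟩ := exists_surjective_superposeHom n
  refine ⟨ψ, fun f => ?_⟩
  obtain ⟨g, rfl⟩ := hψ f
  refine ⟨fun q => (g q).toContinuousMap, fun x => ?_⟩
  simp [superposeHom_apply, superpose_apply]

end
end
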